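/- arXiv:2411.07499 — 4 statements merged into one kernel-verified Lean document; each statement's English description precedes it below -/
import Mathlib

section
/- Let k ≥ 2 be an integer and let G be a finite simple bipartite graph with vertex parts of sizes L and R and with m edges. If m > 100·k·(L + R + (L·R)^((k+1)/(2k))), then G contains a copy of C_{2k}, i.e., a subgraph isomorphic to the cycle graph on 2k vertices. -/
open SimpleGraph

section EvenCycles

variable {V : Type*} {G : SimpleGraph V}

/-- A path whose endpoints are adjacent closes up to a cycle. -/
lemma cycleGraph_isContained_of_isPath {u v : V} {p : G.Walk u v} (hp : p.IsPath)
    (h : G.Adj v u) : cycleGraph (p.length + 1) ⊑ G := by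
  refine ⟨⟨⟨fun j => p.getVert j, ?_⟩, ?_⟩⟩
  · have key : ∀ a b : Fin (p.length + 1), (a - b).val = 1 →
        G.Adj (p.getVert a) (p.getVert b) := by
      intro a b hab
      rcases le_or_gt b a with hba | hba
      · rw [Fin.sub_val_of_le hba] at hab
        have : (a : ℕ) = b + 1 := by omega
        rw [this]
        exact (p.adj_getVert_succ (by omega)).symm
      · rw [Fin.coe_sub_iff_lt.mpr hba] at hab
        have ha : (a : ℕ) = 0 := by omega
        have hb : (b : ℕ) = p.length := by omega
        rw [ha, hb, p.getVert_zero, p.getVert_length]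
        exact h.symm
    intro a b hab
    rcases cycleGraph_adj'.mp hab with hab | hab
    · exact key a b hab
    · exact (key b a hab).symm
  · intro a b hab
    exact Fin.ext (hp.getVert_injOn (Nat.lt_succ_iff.mp a.2) (Nat.lt_succ_iff.mp b.2) hab)

/-- A path staying above the level of its two endpoints is closed up to a cycle by the
two lines of ancestors of these endpoints, up to the first common ancestor. -/
lemma cycleGraph_isContained_of_ancestors {lev : V → ℕ∞} {parent : V → V}
    (hparent : ∀ (n : ℕ) v, lev v = (n + 1 : ℕ) → G.Adj v (parent v) ∧ lev (parent v) = n)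
    (h : ℕ) : ∀ (i : ℕ) {u v : V} (q : G.Walk u v), q.IsPath → h < i → lev u = i → lev v = i →
      (∀ x ∈ q.support, (i : ℕ∞) ≤ lev x) → parent^[h + 1] u = parent^[h + 1] v →
      parent^[h] u ≠ parent^[h] v → cycleGraph (q.length + 2 * (h + 1)) ⊑ G := by
  induction h with
  | zero =>
    intro i u v q hq hi hu hv hsupp heq hne
    obtain ⟨i, rfl⟩ := Nat.exists_eq_add_one_of_ne_zero (by omega : i ≠ 0)
    obtain ⟨hau, hlu⟩ := hparent i u hu
    obtain ⟨hav, hlv⟩ := hparent i v hv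
    have heq : parent u = parent v := heq
    have hmem : parent v ∉ q.support := fun hm => by
      have := hsupp _ hm
      rw [hlv] at this
      norm_cast at this
      omega
    have := cycleGraph_isContained_of_isPath (hq.concat hmem hav) (heq ▸ hau.symm)
    rwa [Walk.length_concat] at this
  | succ h ih =>
    intro i u v q hq hi hu hv hsupp heq hne
    obtain ⟨i, rfl⟩ := Nat.exists_eq_add_one_of_ne_zero (by omega : i ≠ 0)
    obtain ⟨hau, hlu⟩ := hparent i u hu
    obtain ⟨hav, hlv⟩ := hparent i v hv
    have hmem : ∀ x, lev x = i → x ∉ q.support := fun x hx hm => by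
      have := hsupp _ hm
      rw [hx] at this
      norm_cast at this
      omega
    have hpne : parent u ≠ parent v := fun e => hne (by
      rw [Function.iterate_succ_apply, Function.iterate_succ_apply, e])
    have hpath : ((q.concat hav).cons hau.symm).IsPath := by
      rw [Walk.cons_isPath_iff]
      refine ⟨hq.concat (hmem _ hlv) hav, ?_⟩
      rw [Walk.support_concat]
      simp [hmem _ hlu, hpne]
    have := ih i _ hpath (by omega) hlu hlv (by
      intro x hx
      rw [Walk.support_cons, Walk.support_concat] at hx
      simp only [List.mem_cons, List.mem_append, List.not_mem_nil,
        or_false] at hx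
      rcases hx with rfl | hx | rfl
      · exact hlu.ge
      · refine le_trans ?_ (hsupp x hx)
        norm_cast
        omega
      · exact hlv.ge) heq hne
    have hlen : ((q.concat hav).cons hau.symm).length + 2 * (h + 1)
        = q.length + 2 * (h + 1 + 1) := by
      simp only [Walk.length_cons, Walk.length_concat]
      ring
    rwa [hlen] at this

open Classical in
/-- Large degrees allow to extend paths greedily, avoiding a small set of vertices. -/
lemma exists_isPath_avoiding [Fintype V] {D : ℕ}
    (hdeg : ∀ u v, G.Adj u v → D < G.degree u) (n : ℕ) : ∀ (F : Finset V) (u w : V), u ∉ F →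
      G.Adj u w → F.card + n ≤ D → ∃ (z : V) (q : G.Walk u z), q.IsPath ∧ q.length = n ∧
        ∀ x ∈ q.support, x ∉ F := by
  induction n with
  | zero =>
    intro F u w hu _ _
    exact ⟨u, .nil, by simp, rfl, by simpa using hu⟩
  | succ n ih =>
    intro F u w hu hw hF
    have hcard := Finset.card_insert_le u F
    obtain ⟨u', hu', hu'F⟩ : ∃ u' ∈ G.neighborFinset u, u' ∉ insert u F := by
      apply Finset.exists_mem_notMem_of_card_lt_card
      rw [card_neighborFinset_eq_degree]
      have := hdeg u w hw
      omega
    rw [mem_neighborFinset] at hu'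
    obtain ⟨z, q, hq, hlen, hsupp⟩ := ih (insert u F) u' u hu'F hu'.symm (by omega)
    refine ⟨z, q.cons hu', ?_, by simp [hlen], ?_⟩
    · rw [Walk.cons_isPath_iff]
      exact ⟨hq, fun hm => hsupp u hm (Finset.mem_insert_self _ _)⟩
    · intro x hx
      rw [Walk.support_cons, List.mem_cons] at hx
      rcases hx with rfl | hx
      · exact hu
      · exact fun hxF => hsupp x hx (Finset.mem_insert_of_mem hxF)

/-- In a graph with parts `X` and `Y`, a function which is constant on the neighbourhood of each
vertex of `Y` is constant along walks, read at every other vertex. -/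
lemma eq_of_walk_of_even {X Y : Set V} {α : Type*} {g : V → α}
    (hXY : ∀ u v, G.Adj u v → u ∈ X → v ∈ Y) (hYX : ∀ u v, G.Adj u v → u ∈ Y → v ∈ X)
    (hg : ∀ y ∈ Y, ∀ u v, G.Adj y u → G.Adj y v → g u = g v) (n : ℕ) :
    ∀ {u z : V} (q : G.Walk u z), q.length = 2 * n → u ∈ X → z ∈ X ∧ g u = g z := by
  induction n with
  | zero =>
    intro u z q hq hu
    obtain rfl := Walk.eq_of_length_eq_zero (p := q) (by omega)
    exact ⟨hu, rfl⟩
  | succ n ih =>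
    intro u z q hq hu
    match q, hq with
    | .cons h (.cons h' q), hq =>
      have hy := hXY _ _ h hu
      obtain ⟨hz, he⟩ := ih q (by simpa [mul_add] using hq) (hYX _ _ h' hy)
      exact ⟨hz, (hg _ hy _ _ h.symm h').trans he⟩

open Classical in
/-- If `f` is not constant on the neighbourhood of some `y`, then there are paths of prescribed
even length whose ends are distinguished by `f`. -/
lemma exists_isPath_of_ne [Fintype V] {X Y : Set V} {α β : Type*} {g : V → α} {f : V → β}
    {D n : ℕ} (hdeg : ∀ u v, G.Adj u v → D < G.degree u)
    (hXY : ∀ u v, G.Adj u v → u ∈ X → v ∈ Y) (hYX : ∀ u v, G.Adj u v → u ∈ Y → v ∈ X)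
    (hg : ∀ y ∈ Y, ∀ u v, G.Adj y u → G.Adj y v → g u = g v) (hD : 2 * n + 3 ≤ D)
    {y u v : V} (hy : y ∈ Y) (hu : G.Adj y u) (hv : G.Adj y v) (huv : f u ≠ f v) :
    ∃ (a b : V) (q : G.Walk a b), q.IsPath ∧ q.length = 2 * (n + 1) ∧ a ∈ X ∧ b ∈ X ∧
      g a = g b ∧ f a ≠ f b := by
  have main : ∀ u v w, G.Adj y u → G.Adj y v → G.Adj y w → u ≠ v → u ≠ w → f v ≠ f w →
      ∃ (a b : V) (q : G.Walk a b), q.IsPath ∧ q.length = 2 * (n + 1) ∧ a ∈ X ∧ b ∈ X ∧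
        g a = g b ∧ f a ≠ f b := by
    intro u v w hu hv hw huv huw hvw
    have hF : ({y, v, w} : Finset V).card ≤ 3 := Finset.card_le_three
    obtain ⟨z, q, hq, hlen, hsupp⟩ := exists_isPath_avoiding hdeg (2 * n) {y, v, w} u y
      (by simp [huv, huw, hu.ne']) hu.symm (by omega)
    have hyq : y ∉ q.support := fun hm => hsupp y hm (by simp)
    have ext : ∀ a, G.Adj y a → a ∉ q.support → f a ≠ f z →
        ∃ (a b : V) (q : G.Walk a b), q.IsPath ∧ q.length = 2 * (n + 1) ∧ a ∈ X ∧ b ∈ X ∧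
          g a = g b ∧ f a ≠ f b := by
      intro a ha haq hfa
      have hlen' : ((q.cons hu).cons ha.symm).length = 2 * (n + 1) := by
        simp [hlen, mul_add]
      have haX := hYX _ _ ha hy
      obtain ⟨hz, he⟩ := eq_of_walk_of_even hXY hYX hg (n + 1) _ hlen' haX
      refine ⟨a, z, _, ?_, hlen', haX, hz, he, hfa⟩
      rw [Walk.cons_isPath_iff, Walk.cons_isPath_iff]
      refine ⟨⟨hq, hyq⟩, ?_⟩
      simp [haq, ha.ne']
    by_cases hfz : f v = f z
    · exact ext w hw (fun hm => hsupp w hm (by simp)) (fun e => hvw (hfz.trans e.symm))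
    · exact ext v hv (fun hm => hsupp v hm (by simp)) hfz
  obtain ⟨w, hw, hwF⟩ : ∃ w ∈ G.neighborFinset y, w ∉ ({u, v} : Finset V) := by
    apply Finset.exists_mem_notMem_of_card_lt_card
    rw [card_neighborFinset_eq_degree]
    have := hdeg y u hu
    have : ({u, v} : Finset V).card ≤ 2 := Finset.card_le_two
    omega
  rw [mem_neighborFinset] at hw
  simp only [Finset.mem_insert, Finset.mem_singleton, not_or] at hwF
  exact main w u v hw hu hv hwF.1 hwF.2 huv

open Classical in
/-- A subgraph of large minimum degree between two consecutive levels of a rooted tree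
yields a cycle of length `2k`. -/
lemma cycleGraph_isContained_of_levels [Fintype V] {H : SimpleGraph V} (hHG : H ≤ G)
    {lev : V → ℕ∞} {parent : V → V} {r : V} (hr : ∀ v, lev v = 0 → v = r)
    (hparent : ∀ (n : ℕ) v, lev v = (n + 1 : ℕ) → G.Adj v (parent v) ∧ lev (parent v) = n)
    {i k : ℕ} (hik : i < k)
    (hH : ∀ u v, H.Adj u v → (lev u = i ∧ lev v = (i + 1 : ℕ)) ∨
      (lev u = (i + 1 : ℕ) ∧ lev v = i))
    (hne : H ≠ ⊥) (hdeg : ∀ u v, H.Adj u v → 2 * k < H.degree u) :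
    cycleGraph (2 * k) ⊑ G := by
  have hlev : ∀ a b : ℕ, (a : ℕ∞) = b → a = b := fun a b h => by exact_mod_cast h
  have hXY : ∀ u v, H.Adj u v → u ∈ {x | lev x = i} → v ∈ {x | lev x = (i + 1 : ℕ)} := by
    intro u v huv hu
    rcases hH u v huv with h | h
    · exact h.2
    · have := hlev _ _ (hu.symm.trans h.1)
      omega
  have hYX : ∀ u v, H.Adj u v → u ∈ {x | lev x = (i + 1 : ℕ)} → v ∈ {x | lev x = i} := by
    intro u v huv hu
    rcases hH u v huv with h | h
    · have := hlev _ _ (hu.symm.trans h.1)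
      omega
    · exact h.2
  have hroot : ∀ (n : ℕ) v, lev v = n → parent^[n] v = r := by
    intro n
    induction n with
    | zero => exact fun v hv => hr v (by simpa using hv)
    | succ n ih => exact fun v hv => ih _ (hparent n v hv).2
  let P : ℕ → Prop := fun h => ∀ y ∈ {x | lev x = (i + 1 : ℕ)}, ∀ u v, H.Adj y u → H.Adj y v →
    parent^[h] u = parent^[h] v
  have hPi : P i := fun y hy u v hu hv => by
    rw [hroot i u (hYX _ _ hu hy), hroot i v (hYX _ _ hv hy)]
  have hex : ∃ h, P h := ⟨i, hPi⟩
  have hP := Nat.find_spec hex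
  have hle : Nat.find hex ≤ i := Nat.find_min' hex hPi
  have hP0 : Nat.find hex ≠ 0 := by
    intro h0
    rw [h0] at hP
    obtain ⟨y, u, hy, hyu⟩ : ∃ y u, lev y = (i + 1 : ℕ) ∧ H.Adj y u := by
      obtain ⟨a, b, hab⟩ := ne_bot_iff_exists_adj.mp hne
      rcases hH a b hab with h | h
      · exact ⟨b, a, h.2, hab.symm⟩
      · exact ⟨a, b, h.1, hab⟩
    have h1 : 1 < (H.neighborFinset y).card := by
      rw [card_neighborFinset_eq_degree]
      have := hdeg y u hyu
      omega
    obtain ⟨a, ha, b, hb, hab⟩ := Finset.one_lt_card.mp h1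
    rw [mem_neighborFinset] at ha hb
    exact hab (hP y hy a b ha hb)
  obtain ⟨h, hh⟩ := Nat.exists_eq_add_one_of_ne_zero hP0
  have hnP : ¬ P h := Nat.find_min hex (by omega)
  rw [hh] at hP
  simp only [P, not_forall] at hnP
  obtain ⟨y, hy, u, v, hu, hv, huv⟩ := hnP
  obtain ⟨a, b, q, hq, hlen, ha, hb, hg, hf⟩ := exists_isPath_of_ne (n := k - h - 2) hdeg hXY hYX hP
    (by omega) hy hu hv huv
  have key := cycleGraph_isContained_of_ancestors hparent h i (q.mapLe hHG)
    ((Walk.isPath_mapLe hHG).mpr hq) (by omega) ha hb (by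
      intro x hx
      have hx : x ∈ q.support := by simpa using hx
      obtain ⟨w, hw⟩ : ∃ w, H.Adj x w := by
        have hnn : ¬ q.Nil := fun hn => hf (congrArg _ hn.eq)
        obtain ⟨e, he, hxe⟩ := (Walk.mem_support_iff_exists_mem_edges_of_not_nil hnn).mp hx
        obtain ⟨w, rfl⟩ := hxe
        exact ⟨w, q.adj_of_mem_edges he⟩
      rcases hH x w hw with h | h
      · exact h.1.ge
      · rw [h.1]
        norm_cast
        omega) hg hf
  have : (q.mapLe hHG).length + 2 * (h + 1) = 2 * k := by
    simp only [Walk.length_map, hlen]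
    omega
  rwa [this] at key

open Classical Finset in
/-- A graph with more edges than the total weight of the vertices contains a nonempty subgraph
each of whose non-isolated vertices has degree larger than its weight. -/
lemma exists_le_forall_lt_degree [Fintype V] {w : V → ℝ} (hw : ∀ v, 0 ≤ w v) (S : Finset V) :
    ∀ G : SimpleGraph V, (∀ u v, G.Adj u v → u ∈ S) → ∑ v ∈ S, w v < #G.edgeFinset →
      ∃ H ≤ G, H ≠ ⊥ ∧ ∀ u v, H.Adj u v → w u < H.degree u := by
  induction S using Finset.strongInduction with
  | H S ih =>
    intro G hS hG
    by_cases hgood : ∀ u v, G.Adj u v → w u < G.degree u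
    · refine ⟨G, le_rfl, ?_, hgood⟩
      have hpos : (0 : ℝ) < #G.edgeFinset := (sum_nonneg fun v _ => hw v).trans_lt hG
      obtain ⟨e, he⟩ := card_pos.mp (Nat.cast_pos.mp hpos)
      rw [mem_edgeFinset] at he
      rintro rfl
      simp at he
    · push Not at hgood
      obtain ⟨u, v, huv, hdeg⟩ := hgood
      have hu := hS u v huv
      have hle : G.deleteIncidenceSet u ≤ G := G.deleteIncidenceSet_le u
      obtain ⟨H, hH, hne, h⟩ := ih (S.erase u) (Finset.erase_ssubset hu)
        (G.deleteIncidenceSet u) (by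
          intro a b hab
          rw [deleteIncidenceSet_adj] at hab
          exact Finset.mem_erase.mpr ⟨hab.2.1, hS a b hab.1⟩) (by
          refine lt_of_lt_of_eq (b := ((#G.edgeFinset - G.degree u : ℕ) : ℝ)) ?_ (by
            congr 1
            convert (card_edgeFinset_deleteIncidenceSet G u).symm)
          have h1 := Finset.add_sum_erase S w hu
          have h2 : (#G.edgeFinset : ℝ) ≤ ((#G.edgeFinset - G.degree u : ℕ) : ℝ) + G.degree u := by
            norm_cast
            omega
          linarith)
      exact ⟨H, hH.trans hle, hne, h⟩

lemma edist_le_edist_add_one_of_adj (r : V) {u v : V} (h : G.Adj u v) :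
    G.edist r v ≤ G.edist r u + 1 :=
  (SimpleGraph.edist_triangle (v := u)).trans_eq (by rw [edist_eq_one_iff_adj.mpr h])

lemma exists_adj_edist_eq {r v : V} {n : ℕ} (h : G.edist r v = (n + 1 : ℕ)) :
    ∃ u, G.Adj v u ∧ G.edist r u = n := by
  rw [edist_comm] at h
  obtain ⟨p, hp⟩ := exists_walk_of_edist_eq_coe h
  match p, hp with
  | .cons (v := u) hu q, hp =>
    refine ⟨u, hu, le_antisymm ?_ ?_⟩
    · rw [edist_comm]
      refine (edist_le q).trans ?_
      simp only [Walk.length_cons, add_left_inj] at hp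
      exact_mod_cast hp.le
    · have := edist_le_edist_add_one_of_adj r hu.symm
      rw [edist_comm] at h
      rw [h, Nat.cast_add, Nat.cast_one] at this
      exact (ENat.add_le_add_iff_right ENat.one_ne_top).mp this

/-- The bipartite graph formed by the edges between the vertices at distance `i` from `r` and the
vertices at distance `i + 1`. -/
def levelGraph (G : SimpleGraph V) (r : V) (i : ℕ) : SimpleGraph V where
  Adj u v := G.Adj u v ∧ ((G.edist r u = i ∧ G.edist r v = (i + 1 : ℕ)) ∨
    (G.edist r u = (i + 1 : ℕ) ∧ G.edist r v = i))
  symm := ⟨fun _ _ h => ⟨h.1.symm, h.2.symm.imp And.symm And.symm⟩⟩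
  loopless := ⟨fun _ h => G.irrefl h.1⟩

lemma adj_level_cases {r u v : V} {i : ℕ} (hv : G.edist r v = i) (h : G.Adj v u)
    (hne : G.edist r u ≠ i) :
    (levelGraph G r i).Adj v u ∨ ∃ j, i = j + 1 ∧ (levelGraph G r j).Adj v u := by
  have h1 := edist_le_edist_add_one_of_adj r h
  have h2 := edist_le_edist_add_one_of_adj r h.symm
  rw [hv] at h1 h2
  obtain ⟨n, hn⟩ : ∃ n : ℕ, G.edist r u = n := by
    refine ⟨(G.edist r u).toNat, (ENat.natCast_toNat fun htop => ?_).symm⟩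
    rw [htop] at h1
    exact absurd h1 (by simp)
  rw [hn] at h1 h2 hne
  norm_cast at h1 h2 hne
  rcases (by omega : n = i + 1 ∨ i = n + 1) with rfl | rfl
  · exact .inl ⟨h, .inl ⟨hv, hn⟩⟩
  · exact .inr ⟨n, rfl, h, .inr ⟨hv, hn⟩⟩

section Counting

open Classical Finset

variable [Fintype V]

/-- The vertices at distance `i` from `r`. -/
noncomputable def level (G : SimpleGraph V) (r : V) (i : ℕ) : Finset V :=
  {v | G.edist r v = i}

lemma mem_level {r v : V} {i : ℕ} : v ∈ level G r i ↔ G.edist r v = i := by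
  simp [level]

lemma levelGraph_isBipartiteWith (r : V) (i : ℕ) :
    (levelGraph G r i).IsBipartiteWith (level G r i : Set V) (level G r (i + 1)) where
  disjoint := by
    rw [Set.disjoint_left]
    intro v h h'
    rw [mem_coe, mem_level] at h h'
    have := h.symm.trans h'
    norm_cast at this
    omega
  mem_of_adj := by
    intro u v h
    simpa only [mem_coe, mem_level] using h.2

lemma card_edgeFinset_levelGraph_le {r : V} {i k : ℕ} (hik : i < k)
    (hfree : ¬ cycleGraph (2 * k) ⊑ G) :
    #(levelGraph G r i).edgeFinset ≤ 2 * k * (#(level G r i) + #(level G r (i + 1))) := by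
  by_contra! hlt
  have hpar : ∀ v, ∃ u, ∀ n : ℕ, G.edist r v = (n + 1 : ℕ) → G.Adj v u ∧ G.edist r u = n := by
    intro v
    by_cases hv : ∃ n : ℕ, G.edist r v = (n + 1 : ℕ)
    · obtain ⟨n, hn⟩ := hv
      obtain ⟨u, hu⟩ := exists_adj_edist_eq hn
      refine ⟨u, fun m hm => ?_⟩
      have := hn.symm.trans hm
      norm_cast at this
      obtain rfl : n = m := by omega
      exact hu
    · exact ⟨v, fun n hn => absurd ⟨n, hn⟩ hv⟩
  choose parent hparent using hpar
  obtain ⟨H, hH, hne, hdeg⟩ := exists_le_forall_lt_degree (w := fun _ => (2 * k : ℕ))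
    (fun _ => Nat.cast_nonneg _) (level G r i ∪ level G r (i + 1)) (levelGraph G r i) (by
      intro u v h
      rw [mem_union, mem_level, mem_level]
      exact h.2.imp And.left And.left) (by
      rw [sum_const, nsmul_eq_mul]
      norm_cast
      refine lt_of_le_of_lt ?_ hlt
      rw [mul_comm]
      exact Nat.mul_le_mul_left _ (card_union_le _ _))
  refine hfree (cycleGraph_isContained_of_levels (hH.trans fun _ _ h => h.1)
    (lev := G.edist r) (parent := parent) (r := r)
    (fun v hv => (edist_eq_zero_iff.mp hv).symm) (fun n v => hparent v n) hik
    (fun u v h => (hH h).2) hne ?_)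
  intro u v h
  exact_mod_cast hdeg u v h

lemma sum_degree_level_zero_le {r : V}
    (hlev : ∀ u v, G.Adj u v → ∀ i : ℕ, G.edist r u = i → G.edist r v ≠ i) :
    ∑ v ∈ level G r 0, G.degree v ≤ #(levelGraph G r 0).edgeFinset := by
  rw [← isBipartiteWith_sum_degrees_eq_card_edges (levelGraph_isBipartiteWith r 0)]
  refine sum_le_sum fun v hv => ?_
  rw [mem_level] at hv
  refine card_le_card fun u hu => ?_
  rw [mem_neighborFinset] at hu ⊢
  rcases adj_level_cases hv hu (hlev _ _ hu _ hv) with h | ⟨j, hj, _⟩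
  · exact h
  · omega

lemma sum_degree_level_succ_le {r : V} {i : ℕ}
    (hlev : ∀ u v, G.Adj u v → ∀ i : ℕ, G.edist r u = i → G.edist r v ≠ i) :
    ∑ v ∈ level G r (i + 1), G.degree v ≤
      #(levelGraph G r i).edgeFinset + #(levelGraph G r (i + 1)).edgeFinset := by
  rw [← isBipartiteWith_sum_degrees_eq_card_edges (levelGraph_isBipartiteWith r (i + 1)),
    ← isBipartiteWith_sum_degrees_eq_card_edges' (levelGraph_isBipartiteWith r i),
    ← sum_add_distrib]
  refine sum_le_sum fun v hv => ?_
  rw [mem_level] at hv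
  refine (card_le_card (t := (levelGraph G r i).neighborFinset v ∪
    (levelGraph G r (i + 1)).neighborFinset v) fun u hu => ?_).trans (card_union_le _ _)
  rw [mem_union, mem_neighborFinset, mem_neighborFinset]
  rw [mem_neighborFinset] at hu
  rcases adj_level_cases hv hu (hlev _ _ hu _ hv) with h | ⟨j, hj, h⟩
  · exact .inr h
  · obtain rfl : i = j := by omega
    exact .inl h

/-- In a graph of large minimum degree without `2k`-cycle whose levels are independent sets, the
levels grow at a rate proportional to the minimum degree inside each level. -/
lemma mul_card_level_le {r : V} {k : ℕ} (hfree : ¬ cycleGraph (2 * k) ⊑ G)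
    (hlev : ∀ u v, G.Adj u v → ∀ i : ℕ, G.edist r u = i → G.edist r v ≠ i)
    {d : ℕ → ℝ} (hd : ∀ i, 25 * k ≤ d i)
    (hdeg : ∀ i, ∀ v ∈ level G r i, d i ≤ G.degree v) :
    ∀ i < k, d i * #(level G r i) ≤ 25 * k * #(level G r (i + 1)) := by
  have hsum : ∀ i, d i * #(level G r i) ≤ ((∑ v ∈ level G r i, G.degree v : ℕ) : ℝ) := by
    intro i
    push_cast
    rw [mul_comm, ← nsmul_eq_mul]
    exact card_nsmul_le_sum _ _ _ (hdeg i)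
  have hedge : ∀ i < k, (#(levelGraph G r i).edgeFinset : ℝ) ≤
      2 * k * (#(level G r i) + #(level G r (i + 1))) := fun i hi => by
    exact_mod_cast card_edgeFinset_levelGraph_le hi hfree
  have hgrow : ∀ i, d i * #(level G r i) ≤ 2 * k * (3 * #(level G r i) + #(level G r (i + 1))) →
      d i * #(level G r i) ≤ 25 * k * #(level G r (i + 1)) := by
    intro i h
    have := mul_le_mul_of_nonneg_right (hd i) (Nat.cast_nonneg (α := ℝ) #(level G r i))
    nlinarith
  intro i
  induction i with
  | zero =>
    intro hk
    apply hgrow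
    have h1 := hsum 0
    have h2 : ((∑ v ∈ level G r 0, G.degree v : ℕ) : ℝ) ≤ #(levelGraph G r 0).edgeFinset := by
      exact_mod_cast sum_degree_level_zero_le hlev
    have h3 := hedge 0 hk
    have h4 : (0 : ℝ) ≤ k * #(level G r 0) := by positivity
    simp only [zero_add] at h3 ⊢
    linarith
  | succ i ih =>
    intro hk
    apply hgrow
    have h1 := hsum (i + 1)
    have h2 : ((∑ v ∈ level G r (i + 1), G.degree v : ℕ) : ℝ) ≤
        #(levelGraph G r i).edgeFinset + #(levelGraph G r (i + 1)).edgeFinset := by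
      exact_mod_cast sum_degree_level_succ_le hlev
    have h3 := hedge i (by omega)
    have h4 := hedge (i + 1) hk
    have h5 := mul_le_mul_of_nonneg_right (hd i) (Nat.cast_nonneg (α := ℝ) #(level G r i))
    have h6 := ih (by omega)
    linarith

omit [Fintype V] in
lemma mem_iff_even_of_edist_eq {A : Finset V} (hA : ∀ u v, G.Adj u v → (u ∈ A ↔ v ∉ A)) {r : V}
    (hr : r ∈ A) (i : ℕ) : ∀ v, G.edist r v = i → (v ∈ A ↔ Even i) := by
  induction i with
  | zero =>
    intro v hv
    obtain rfl := edist_eq_zero_iff.mp hv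
    simpa using hr
  | succ i ih =>
    intro v hv
    obtain ⟨u, hu, hi⟩ := exists_adj_edist_eq hv
    rw [hA v u hu, ih u hi, Nat.even_add_one]

/-- If the size of the levels grows alternately by factors `α` and `β`, then the level at
distance `2j` has size at least `(αβ)^j`. -/
lemma pow_le_card_level {r : V} {k : ℕ} {α β : ℝ} (hα : 0 ≤ α) (hβ : 0 ≤ β)
    (hgrow : ∀ i < k, (if Even i then α else β) * #(level G r i) ≤ #(level G r (i + 1))) :
    ∀ j, 2 * j ≤ k → (α * β) ^ j ≤ #(level G r (2 * j)) := by
  intro j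
  induction j with
  | zero =>
    intro _
    have : r ∈ level G r 0 := by simp [mem_level]
    simpa using ⟨r, this⟩
  | succ j ih =>
    intro hj
    have h0 := ih (by omega)
    have h1 := hgrow (2 * j) (by omega)
    have h2 := hgrow (2 * j + 1) (by omega)
    rw [if_pos (by simp)] at h1
    rw [if_neg (by simp)] at h2
    calc (α * β) ^ (j + 1) = β * (α * (α * β) ^ j) := by ring
      _ ≤ β * (α * #(level G r (2 * j))) := by gcongr
      _ ≤ β * #(level G r (2 * j + 1)) := by gcongr
      _ ≤ #(level G r (2 * (j + 1))) := h2

/-- In a bipartite graph without `2k`-cycle, lower bounds `25 * k * M / #A` and `25 * k * M / #B`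
for the degrees of the non-isolated vertices of the two parts force `M` to be small. -/
lemma pow_le_of_not_cycleGraph_isContained {A B : Finset V} {k : ℕ} {M : ℝ} (hk : 0 < k)
    (hA : ∀ u v, G.Adj u v → (u ∈ A ↔ v ∉ A)) (hB : ∀ v, v ∉ A → v ∈ B) (hG : G ≠ ⊥)
    (hAB : #A ≤ #B) (hfree : ¬ cycleGraph (2 * k) ⊑ G)
    (hdegA : ∀ u v, G.Adj u v → u ∈ A → 25 * k * (M / #A) ≤ G.degree u)
    (hdegB : ∀ u v, G.Adj u v → u ∉ A → 25 * k * (M / #B) ≤ G.degree u) (hM : (#B : ℝ) ≤ M) :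
    M ^ (2 * k) ≤ ((#A : ℝ) * #B) ^ (k + 1) := by
  obtain ⟨r, s, hrs, hr⟩ : ∃ r s, G.Adj r s ∧ r ∈ A := by
    obtain ⟨a, b, hab⟩ := ne_bot_iff_exists_adj.mp hG
    by_cases ha : a ∈ A
    · exact ⟨a, b, hab, ha⟩
    · exact ⟨b, a, hab.symm, by simpa [hA a b hab] using ha⟩
  have hApos : (0 : ℝ) < #A := by exact_mod_cast card_pos.mpr ⟨r, hr⟩
  have hABr : (#A : ℝ) ≤ #B := by exact_mod_cast hAB
  have hBpos : (0 : ℝ) < #B := hApos.trans_le hABr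
  have hα : 1 ≤ M / #A := by rw [one_le_div hApos]; linarith
  have hβ : 1 ≤ M / #B := by rwa [one_le_div hBpos]
  set α := M / #A
  set β := M / #B
  have hαM : α * #A = M := div_mul_cancel₀ _ hApos.ne'
  have hβM : β * #B = M := div_mul_cancel₀ _ hBpos.ne'
  clear_value α β
  have hpar := mem_iff_even_of_edist_eq hA hr
  have hlev : ∀ u v, G.Adj u v → ∀ i : ℕ, G.edist r u = i → G.edist r v ≠ i := by
    intro u v h i hu hv
    have := hA u v h
    rw [hpar i u hu, hpar i v hv] at this
    tauto
  have hnbr : ∀ (i : ℕ) v, G.edist r v = i → ∃ u, G.Adj v u := by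
    intro i v hv
    cases i with
    | zero => exact edist_eq_zero_iff.mp hv ▸ ⟨s, hrs⟩
    | succ i => exact (exists_adj_edist_eq hv).imp fun _ => And.left
  have hk' : (0 : ℝ) < 25 * k := by positivity
  have hgrow : ∀ i < k, (if Even i then α else β) * #(level G r i) ≤ #(level G r (i + 1)) := by
    intro i hi
    have := mul_card_level_le hfree hlev (d := fun i => 25 * k * (if Even i then α else β))
      (fun i => le_mul_of_one_le_right hk'.le (by split_ifs <;> assumption)) (by
        intro i v hv
        rw [mem_level] at hv
        obtain ⟨u, hu⟩ := hnbr i v hv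
        by_cases he : Even i
        · simpa [he] using hdegA v u hu ((hpar i v hv).mpr he)
        · simpa [he] using hdegB v u hu (fun h => he ((hpar i v hv).mp h))) i hi
    rw [mul_assoc] at this
    exact le_of_mul_le_mul_left this hk'
  have hpow := pow_le_card_level (zero_le_one.trans hα) (zero_le_one.trans hβ) hgrow
  have hαβ : 0 ≤ α * β := by positivity
  suffices h : (α * β) ^ k ≤ #A * #B by
    calc M ^ (2 * k) = (α * β) ^ k * (#A * #B) ^ k := by
          rw [← mul_pow, pow_mul]
          congr 1
          linear_combination (-(β * #B)) * hαM - M * hβM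
      _ ≤ (#A * #B) * (#A * #B) ^ k := by gcongr
      _ = ((#A : ℝ) * #B) ^ (k + 1) := by ring
  rcases Nat.even_or_odd' k with ⟨j, rfl | rfl⟩
  · have h1 := hpow j le_rfl
    have h2 : (#(level G r (2 * j)) : ℝ) ≤ #A := by
      norm_cast
      refine card_le_card fun v hv => (hpar _ v (mem_level.mp hv)).mpr (by simp)
    calc (α * β) ^ (2 * j) = (α * β) ^ j * (α * β) ^ j := by ring
      _ ≤ #A * #B := by gcongr <;> linarith
  · have h1 := hpow j (by omega)
    have h2 : (#(level G r (2 * j + 1)) : ℝ) ≤ #B := by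
      norm_cast
      refine card_le_card fun v hv => hB v fun h => ?_
      have := (hpar _ v (mem_level.mp hv)).mp h
      simp at this
    have h3 := hgrow (2 * j) (by omega)
    rw [if_pos (by simp)] at h3
    have h4 : α * (α * β) ^ j ≤ #B :=
      (mul_le_mul_of_nonneg_left h1 (by positivity)).trans (h3.trans h2)
    have h5 : (α * β) ^ (2 * j + 1) * #B = (α * (α * β) ^ j) * (α * (α * β) ^ j) * #A := by
      linear_combination (α * (α * β) ^ (2 * j)) * (hβM - hαM)
    have h6 : (α * (α * β) ^ j) * (α * (α * β) ^ j) ≤ #B * #B :=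
      mul_le_mul h4 h4 (by positivity) hBpos.le
    refine le_of_mul_le_mul_right ?_ hBpos
    rw [h5]
    nlinarith [mul_le_mul_of_nonneg_right h6 hApos.le]

/-- The extremal bound for `2k`-cycles in a bipartite graph whose first part is the smaller one. -/
lemma cycleGraph_isContained_of_card_le {A B : Finset V} {k : ℕ} (hk : 0 < k)
    (hdisj : Disjoint A B) (hcover : ∀ v, v ∈ A ∨ v ∈ B)
    (hbip : ∀ u v, G.Adj u v → (u ∈ A ∧ v ∈ B) ∨ (u ∈ B ∧ v ∈ A)) (hAB : #A ≤ #B)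
    (hbig : 100 * k * ((#A : ℝ) + #B + ((#A : ℝ) * #B) ^ (((k : ℝ) + 1) / (2 * k))) <
      #G.edgeFinset) : cycleGraph (2 * k) ⊑ G := by
  have hkr : (0 : ℝ) < k := by exact_mod_cast hk
  set M : ℝ := #G.edgeFinset / (100 * k) with hMd
  have hM : (#A : ℝ) + #B + ((#A : ℝ) * #B) ^ (((k : ℝ) + 1) / (2 * k)) < M := by
    rw [hMd, lt_div_iff₀ (by positivity)]
    linarith
  have hrpow : 0 ≤ ((#A : ℝ) * #B) ^ (((k : ℝ) + 1) / (2 * k)) := by positivity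
  have hMpos : 0 < M := lt_of_le_of_lt (by positivity) hM
  have hMk : 100 * k * M = #G.edgeFinset := mul_div_cancel₀ _ (by positivity)
  by_contra hfree
  have hBA : ∀ v, v ∈ B ↔ v ∉ A := fun v => by
    refine ⟨fun h h' => disjoint_left.mp hdisj h' h, fun h => ?_⟩
    exact (hcover v).resolve_left h
  have hunion : A ∪ B = univ := eq_univ_iff_forall.mpr fun v => mem_union.mpr (hcover v)
  have hsum : ∀ S : Finset V, ∑ v ∈ S, 25 * k * (M / #S) ≤ 25 * k * M := by
    intro S
    rw [sum_const, nsmul_eq_mul]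
    rcases S.eq_empty_or_nonempty with rfl | hS
    · simp only [card_empty, Nat.cast_zero, zero_mul]
      positivity
    · have : (#S : ℝ) ≠ 0 := by exact_mod_cast hS.card_pos.ne'
      exact le_of_eq (by field_simp)
  obtain ⟨H, hHG, hne, hdeg⟩ := exists_le_forall_lt_degree
    (w := fun v => if v ∈ A then 25 * k * (M / #A) else 25 * k * (M / #B))
    (fun v => by split_ifs <;> positivity) univ G (fun u _ _ => mem_univ u) (by
      rw [← hunion, sum_union hdisj, sum_congr rfl (fun v hv => if_pos hv),
        sum_congr rfl (fun v hv => if_neg ((hBA v).mp hv)), ← hMk]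
      have := hsum A
      have := hsum B
      have : 0 < k * M := by positivity
      linarith)
  have key := pow_le_of_not_cycleGraph_isContained (G := H) (A := A) (B := B) (k := k) (M := M) hk
    (fun u v h => by
      rcases hbip u v (hHG h) with h | h <;> simp_all)
    (fun v => (hBA v).mpr) hne hAB (fun h => hfree (h.trans (.of_le hHG)))
    (fun u v h hu => by simpa [hu] using (hdeg u v h).le)
    (fun u v h hu => by simpa [hu] using (hdeg u v h).le)
    (by have : (0 : ℝ) ≤ #A := Nat.cast_nonneg _
        linarith)
  have hlt : ((#A : ℝ) * #B) ^ (((k : ℝ) + 1) / (2 * k)) < M := by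
    have : (0 : ℝ) ≤ (#A : ℝ) + #B := by positivity
    linarith
  have := pow_lt_pow_left₀ hlt hrpow (n := 2 * k) (by omega)
  rw [← Real.rpow_natCast, ← Real.rpow_mul (by positivity)] at this
  have hexp : ((k : ℝ) + 1) / (2 * k) * ((2 * k : ℕ) : ℝ) = ((k + 1 : ℕ) : ℝ) := by
    push_cast
    field_simp
  rw [hexp, Real.rpow_natCast] at this
  exact absurd key (not_le.mpr this)

end Counting

end EvenCycles

/-- Bondy–Simonovits type extremal bound for bipartite graphs (Thm from DKS):
if a bipartite graph with parts of sizes `L`, `R` has more than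
`100·k·(L + R + (L·R)^((k+1)/(2k)))` edges, it contains a `2k`-cycle. -/
theorem bipartite_extremal_C2k (k : ℕ) (hk : 2 ≤ k)
    {V : Type} [Fintype V] [DecidableEq V] (G : SimpleGraph V) [DecidableRel G.Adj]
    (A B : Finset V) (hdisj : Disjoint A B) (hcover : A ∪ B = Finset.univ)
    (hbip : ∀ u v, G.Adj u v → (u ∈ A ∧ v ∈ B) ∨ (u ∈ B ∧ v ∈ A))
    (L R m : ℕ) (hL : L = A.card) (hR : R = B.card) (hm : m = G.edgeFinset.card)
    (hbig : (m : ℝ) >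
      100 * k * ((L : ℝ) + (R : ℝ) + ((L : ℝ) * (R : ℝ)) ^ (((k : ℝ) + 1) / (2 * (k : ℝ))))) :
    ∃ H : G.Subgraph, Nonempty (H.coe ≃g cycleGraph (2 * k)) := by
  have hC : cycleGraph (2 * k) ⊑ G := by
    subst hL hR hm
    have hmem : ∀ v, v ∈ A ∨ v ∈ B := fun v =>
      Finset.mem_union.mp (hcover ▸ Finset.mem_univ v)
    rcases le_total A.card B.card with hAB | hAB
    · refine cycleGraph_isContained_of_card_le (by omega) hdisj hmem hbip hAB ?_
      convert hbig
    · refine cycleGraph_isContained_of_card_le (by omega) hdisj.symm (fun v => (hmem v).symm)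
        (fun u v h => (hbip u v h).symm) hAB ?_
      rw [add_comm (B.card : ℝ), mul_comm (B.card : ℝ)]
      convert hbig
  obtain ⟨f⟩ := hC
  exact ⟨f.toSubgraph, ⟨f.isoToSubgraph.symm⟩⟩
end

section
/- For every integer k ≥ 2, there exist constants c > 0 and C > 0 (depending only on k) such that every finite simple graph G on n vertices with m ≥ C·n^(1+1/k) edges contains at least c·(m/n)^(2k) copies of C_{2k}. -/
open SimpleGraph

/-- The number of subgraphs of `G` isomorphic to the cycle on `n` vertices. -/
noncomputable def countCopiesOfCycle (n : ℕ) {V : Type*} (G : SimpleGraph V) : ℕ :=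
  {H : G.Subgraph | Nonempty (H.coe ≃g cycleGraph n)}.ncard

/-- Spectral decomposition of the diagonal entries of the powers of a real symmetric matrix. -/
lemma Matrix.IsHermitian.exists_pow_apply_self_eq {V : Type*} [Fintype V] [DecidableEq V]
    {A : Matrix V V ℝ} (hA : A.IsHermitian) :
    ∃ w : V → V → ℝ, (∀ x i, 0 ≤ w x i) ∧ (∀ i, ∑ x, w x i = 1) ∧
      ∀ (j : ℕ) (x : V), (A ^ j) x x = ∑ i, hA.eigenvalues i ^ j * w x i := by
  refine ⟨fun x i => (hA.eigenvectorUnitary : Matrix V V ℝ) x i ^ 2, fun x i => sq_nonneg _,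
    fun i => ?_, fun j x => ?_⟩
  · have h := congrFun (congrFun (Unitary.coe_star_mul_self hA.eigenvectorUnitary) i) i
    rw [Matrix.mul_apply, Matrix.one_apply_eq] at h
    rw [← h]
    refine Finset.sum_congr rfl fun x _ => ?_
    simp [Matrix.star_apply, sq]
  · conv_lhs => rw [hA.spectral_theorem, ← map_pow, Matrix.diagonal_pow,
      Unitary.conjStarAlgAut_apply, Matrix.mul_apply]
    refine Finset.sum_congr rfl fun i _ => ?_
    rw [Matrix.mul_diagonal]
    simp [Matrix.star_apply, sq]
    ring

lemma Matrix.IsHermitian.exists_eigenvalues_eq_of_mulVec {V : Type*} [Fintype V] [DecidableEq V]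
    {A : Matrix V V ℝ} (hA : A.IsHermitian) {v : V → ℝ} (hv : v ≠ 0) {t : ℝ}
    (h : A.mulVec v = t • v) : ∃ i, hA.eigenvalues i = t := by
  have ht : t ∈ spectrum ℝ A := by
    rw [spectrum.mem_iff]
    intro hu
    refine hv (Matrix.mulVec_injective_of_isUnit hu ?_)
    rw [Matrix.sub_mulVec, h, Matrix.mulVec_zero, Algebra.algebraMap_eq_smul_one,
      Matrix.smul_mulVec, Matrix.one_mulVec, sub_self]
  rw [hA.spectrum_real_eq_range_eigenvalues] at ht
  exact ht

lemma pow_mul_pow_add_swap_le {s t : ℝ} (hs : 0 ≤ s) (ht : 0 ≤ t) (a b : ℕ) :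
    s ^ (a + 2) * t ^ (b + 2) + t ^ (a + 2) * s ^ (b + 2) ≤
      s ^ 2 * t ^ (a + b + 2) + t ^ 2 * s ^ (a + b + 2) := by
  have key : 0 ≤ (s ^ a - t ^ a) * (s ^ b - t ^ b) := by
    rcases le_total s t with h | h
    · exact mul_nonneg_of_nonpos_of_nonpos (sub_nonpos.2 (pow_le_pow_left₀ hs h _))
        (sub_nonpos.2 (pow_le_pow_left₀ hs h _))
    · exact mul_nonneg (sub_nonneg.2 (pow_le_pow_left₀ ht h _))
        (sub_nonneg.2 (pow_le_pow_left₀ ht h _))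
  have := mul_nonneg (mul_nonneg (sq_nonneg s) (sq_nonneg t)) key
  ring_nf at this ⊢
  linarith

/-- Log-convexity of the moments `l ↦ (A ^ l) x x`. -/
lemma Matrix.IsHermitian.pow_apply_self_mul_le {V : Type*} [Fintype V] [DecidableEq V]
    {A : Matrix V V ℝ} (hA : A.IsHermitian) {a b : ℕ} (hab : Even (a + b)) (x : V) :
    (A ^ (a + 2)) x x * (A ^ (b + 2)) x x ≤ (A ^ 2) x x * (A ^ (a + b + 2)) x x := by
  obtain ⟨w, hw, -, hpow⟩ := hA.exists_pow_apply_self_eq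
  set μ := hA.eigenvalues
  have habs : ∀ i, |μ i| ^ (a + b + 2) = μ i ^ (a + b + 2) := fun i =>
    Even.pow_abs (by simpa [parity_simps] using hab) _
  have h1 : 2 * ((A ^ (a + 2)) x x * (A ^ (b + 2)) x x) =
      ∑ i, ∑ j, (μ i ^ (a + 2) * μ j ^ (b + 2) + μ j ^ (a + 2) * μ i ^ (b + 2)) *
        (w x i * w x j) := by
    rw [two_mul, hpow, hpow, Finset.sum_mul_sum]
    nth_rw 2 [Finset.sum_comm]
    rw [← Finset.sum_add_distrib]
    refine Finset.sum_congr rfl fun i _ => ?_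
    rw [← Finset.sum_add_distrib]
    exact Finset.sum_congr rfl fun j _ => by ring
  have h2 : 2 * ((A ^ 2) x x * (A ^ (a + b + 2)) x x) =
      ∑ i, ∑ j, (μ i ^ 2 * μ j ^ (a + b + 2) + μ j ^ 2 * μ i ^ (a + b + 2)) *
        (w x i * w x j) := by
    rw [two_mul, hpow, hpow, Finset.sum_mul_sum]
    nth_rw 2 [Finset.sum_comm]
    rw [← Finset.sum_add_distrib]
    refine Finset.sum_congr rfl fun i _ => ?_
    rw [← Finset.sum_add_distrib]
    exact Finset.sum_congr rfl fun j _ => by ring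
  refine le_of_mul_le_mul_left ?_ (two_pos : (0 : ℝ) < 2)
  rw [h1, h2]
  refine Finset.sum_le_sum fun i _ => Finset.sum_le_sum fun j _ =>
    mul_le_mul_of_nonneg_right ?_ (mul_nonneg (hw x i) (hw x j))
  have h := pow_mul_pow_add_swap_le (abs_nonneg (μ i)) (abs_nonneg (μ j)) a b
  rw [habs, habs, sq_abs, sq_abs] at h
  refine le_trans (add_le_add ?_ ?_) h
  · exact (le_abs_self _).trans_eq (by rw [abs_mul, abs_pow, abs_pow])
  · exact (le_abs_self _).trans_eq (by rw [abs_mul, abs_pow, abs_pow])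

lemma Matrix.IsHermitian.trace_pow_eq_sum {V : Type*} [Fintype V] [DecidableEq V]
    {A : Matrix V V ℝ} (hA : A.IsHermitian) (j : ℕ) :
    (A ^ j).trace = ∑ i, hA.eigenvalues i ^ j := by
  obtain ⟨w, -, hsum, hpow⟩ := hA.exists_pow_apply_self_eq
  simp_rw [Matrix.trace, Matrix.diag_apply, hpow]
  rw [Finset.sum_comm]
  simp_rw [← Finset.mul_sum, hsum, mul_one]

lemma Matrix.IsHermitian.sum_pow_apply_self_mul_le {V : Type*} [Fintype V] [DecidableEq V]
    {A : Matrix V V ℝ} (hA : A.IsHermitian) {ε : ℝ} (hdiag : ∀ x, A x x = 0)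
    (hε : ∀ x, (A ^ 2) x x ≤ ε) (hε0 : 0 ≤ ε) {k l r : ℕ} (hl : 1 ≤ l) (hr : 1 ≤ r)
    (hlr : l + r = 2 * k + 2) :
    ∑ x, (A ^ l) x x * (A ^ r) x x ≤ ε * (A ^ (2 * k)).trace := by
  have hpos : ∀ x, 0 ≤ (A ^ (2 * k)) x x := fun x => by
    obtain ⟨w, hw, -, hpow⟩ := hA.exists_pow_apply_self_eq
    rw [hpow]
    exact Finset.sum_nonneg fun i _ => mul_nonneg ((even_two_mul k).pow_nonneg _) (hw x i)
  simp_rw [Matrix.trace, Finset.mul_sum]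
  refine Finset.sum_le_sum fun x _ => ?_
  rw [Matrix.diag_apply]
  rcases hl.eq_or_lt with rfl | hl
  · simpa [hdiag] using mul_nonneg hε0 (hpos x)
  rcases hr.eq_or_lt with rfl | hr
  · simpa [hdiag] using mul_nonneg hε0 (hpos x)
  obtain ⟨a, rfl⟩ := Nat.exists_eq_add_of_le' hl
  obtain ⟨b, rfl⟩ := Nat.exists_eq_add_of_le' hr
  have hab : a + b + 2 = 2 * k := by omega
  refine (hA.pow_apply_self_mul_le ⟨k - 1, by omega⟩ x).trans ?_
  rw [hab]
  exact mul_le_mul_of_nonneg_right (hε x) (hpos x)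

/-- Expansion of the trace of a product of matrices over closed sequences of vertices. -/
lemma Matrix.trace_mul_prod_range {V : Type*} [Fintype V] [DecidableEq V]
    (M : ℕ → Matrix V V ℝ) (n : ℕ) (A : Matrix V V ℝ) :
    (A * ((List.range n).map M).prod).trace =
      ∑ f : Fin (n + 1) → V, A (f (Fin.last n)) (f 0) *
        ∏ i : Fin n, M i (f i.castSucc) (f i.succ) := by
  induction n generalizing A with
  | zero =>
    rw [← Equiv.sum_comp (Equiv.funUnique (Fin 1) V).symm]
    simp [Matrix.trace]
  | succ n ih =>
    rw [List.prod_range_succ, ← mul_assoc, Matrix.trace_mul_comm, ← mul_assoc, ih]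
    conv_rhs => rw [← Equiv.sum_comp (Fin.snocEquiv fun _ => V), Fintype.sum_prod_type,
      Finset.sum_comm]
    refine Finset.sum_congr rfl fun g _ => ?_
    rw [Matrix.mul_apply, Finset.sum_mul]
    refine Finset.sum_congr rfl fun v _ => ?_
    rw [Fin.prod_univ_castSucc]
    have h0 : (Fin.snoc g v : Fin (n + 2) → V) 0 = g 0 := by
      rw [← Fin.castSucc_zero, Fin.snoc_castSucc]
    simp only [Fin.snocEquiv_apply, Fin.snoc_last, Fin.snoc_castSucc, Fin.succ_last,
      Fin.val_castSucc, Fin.val_last, h0, ← Fin.castSucc_succ]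
    ring

lemma Matrix.trace_prod_range {V : Type*} [Fintype V] [DecidableEq V]
    (M : ℕ → Matrix V V ℝ) (n : ℕ) [NeZero n] :
    (((List.range n).map M).prod).trace = ∑ f : Fin n → V, ∏ i : Fin n, M i (f i) (f (i + 1)) := by
  obtain ⟨n, rfl⟩ := Nat.exists_eq_succ_of_ne_zero (NeZero.ne n)
  rw [List.prod_range_succ, Matrix.trace_mul_comm, Matrix.trace_mul_prod_range]
  refine Finset.sum_congr rfl fun f _ => ?_
  rw [Fin.prod_univ_castSucc, mul_comm]
  simp

lemma Matrix.sum_filter_eq_prod {V : Type*} [Fintype V] [DecidableEq V]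
    (A : Matrix V V ℝ) {n : ℕ} [NeZero n] {i j : Fin n} (hij : i < j) :
    ∑ f : Fin n → V with f i = f j, ∏ l, A (f l) (f (l + 1)) =
      ∑ y, (A ^ (j - i : ℕ)) y y * (A ^ (n - (j - i) : ℕ)) y y := by
  have hfib : ∑ f : Fin n → V with f i = f j, ∏ l, A (f l) (f (l + 1)) =
      ∑ y, ∑ f : Fin n → V, if f i = y ∧ f j = y then ∏ l, A (f l) (f (l + 1)) else 0 := by
    rw [Finset.sum_filter, Finset.sum_comm]
    refine Finset.sum_congr rfl fun f _ => ?_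
    by_cases h : f i = f j <;> simp [h, ite_and]
    grind
  rw [hfib]
  refine Finset.sum_congr rfl fun y _ => ?_
  set M : ℕ → Matrix V V ℝ := fun l =>
    if l = i ∨ l = j then Matrix.single y y 1 * A else A with hM
  have htr : ∑ f : Fin n → V, (if f i = y ∧ f j = y then ∏ l, A (f l) (f (l + 1)) else 0) =
      (((List.range n).map M).prod).trace := by
    rw [Matrix.trace_prod_range]
    refine Finset.sum_congr rfl fun f _ => ?_
    split_ifs with h
    · refine Finset.prod_congr rfl fun l _ => ?_
      simp only [hM]
      split_ifs with hl
      · rw [Fin.val_inj, Fin.val_inj] at hl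
        have : f l = y := by rcases hl with rfl | rfl; exacts [h.1, h.2]
        rw [this, Matrix.single_mul_apply_same, one_mul]
      · rfl
    · obtain ⟨l, hl, hne⟩ : ∃ l, (l = i ∨ l = j) ∧ f l ≠ y := by grind
      refine (Finset.prod_eq_zero (Finset.mem_univ l) ?_).symm
      simp only [hM]
      rw [if_pos (by rwa [Fin.val_inj, Fin.val_inj]), Matrix.single_mul_apply_of_ne _ _ _ _ _ hne]
  have hconst : ∀ (N : ℕ → Matrix V V ℝ) (b : ℕ), (∀ l < b, N l = A) →
      ((List.range b).map N).prod = A ^ b := fun N b h => by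
    rw [List.map_congr_left (g := fun _ => A) fun l hl => h l (List.mem_range.1 hl)]
    simp
  obtain ⟨a, ha⟩ : ∃ a, (j : ℕ) = i + 1 + a := Nat.exists_eq_add_of_le hij
  obtain ⟨b, hb⟩ : ∃ b, n = i + 1 + a + 1 + b :=
    ⟨n - (i + 1 + a + 1), by have := j.2; omega⟩
  have hprod : ((List.range n).map M).prod =
      A ^ (i : ℕ) * (Matrix.single y y 1 * A ^ (a + 1) * Matrix.single y y 1) * A ^ (b + 1) := by
    have : (List.range n).map M = (List.range (i + 1 + a + 1 + b)).map M := by rw [← hb]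
    rw [this]
    simp only [List.range_add, List.map_append, List.prod_append, List.map_map]
    rw [hconst M i (fun l hl => by grind), hconst (M ∘ _) a (fun l hl => by grind),
      hconst (M ∘ _) b (fun l hl => by grind)]
    have h1 : M i = Matrix.single y y 1 * A := by grind
    have h2 : M (i + 1 + a) = Matrix.single y y 1 * A := by grind
    simp [h1, h2, pow_succ', mul_assoc]
  rw [htr, hprod, Matrix.single_mul_mul_single, Matrix.trace_mul_comm, ← mul_assoc, ← pow_add,
    Matrix.trace_mul_comm, Matrix.trace_single_mul]
  rw [show (j : ℕ) - i = a + 1 by omega, show n - (a + 1) = b + 1 + i by omega]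
  simp

/-- The random walk matrix of `G`, symmetrized by conjugation. -/
noncomputable def SimpleGraph.normAdjMatrix {V : Type*} [Fintype V] (G : SimpleGraph V)
    [DecidableRel G.Adj] : Matrix V V ℝ :=
  Matrix.of fun x y => if G.Adj x y then (√(G.degree x))⁻¹ * (√(G.degree y))⁻¹ else 0

namespace SimpleGraph

section NormAdjMatrix

variable {V : Type*} [Fintype V] (G : SimpleGraph V) [DecidableRel G.Adj]

lemma normAdjMatrix_apply (x y : V) : G.normAdjMatrix x y =
    if G.Adj x y then (√(G.degree x))⁻¹ * (√(G.degree y))⁻¹ else 0 := rfl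

lemma isHermitian_normAdjMatrix : G.normAdjMatrix.IsHermitian := by
  ext x y
  simp [normAdjMatrix_apply, G.adj_comm, mul_comm]

lemma normAdjMatrix_nonneg (x y : V) : 0 ≤ G.normAdjMatrix x y := by
  rw [normAdjMatrix_apply]
  positivity

variable {G}

lemma normAdjMatrix_le {δ : ℝ} (hδ : 0 < δ)
    (hdeg : ∀ x y, G.Adj x y → δ ≤ G.degree x) (x y : V) :
    G.normAdjMatrix x y ≤ δ⁻¹ := by
  rw [normAdjMatrix_apply]
  split_ifs with h
  · calc (√(G.degree x))⁻¹ * (√(G.degree y))⁻¹ ≤ (√δ)⁻¹ * (√δ)⁻¹ := by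
          have := hdeg x y h
          have := hdeg y x h.symm
          have := Real.sqrt_pos.2 hδ
          gcongr
      _ = δ⁻¹ := by rw [← mul_inv, Real.mul_self_sqrt hδ.le]
  · positivity

lemma normAdjMatrix_sq_apply_self_le [DecidableEq V] {δ : ℝ} (hδ : 0 < δ)
    (hdeg : ∀ x y, G.Adj x y → δ ≤ G.degree x) (x : V) :
    (G.normAdjMatrix ^ 2) x x ≤ δ⁻¹ := by
  rcases (G.degree x).eq_zero_or_pos with h0 | h0
  · rw [pow_two, Matrix.mul_apply]
    have h : ∀ y, ¬ G.Adj x y := fun y h => (G.degree_pos_iff_exists_adj x |>.2 ⟨y, h⟩).ne' h0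
    simp [normAdjMatrix_apply, h, hδ.le]
  have hx : (0 : ℝ) < G.degree x := by exact_mod_cast h0
  calc (G.normAdjMatrix ^ 2) x x = ∑ y, if G.Adj x y then
        (G.degree x : ℝ)⁻¹ * (G.degree y : ℝ)⁻¹ else 0 := by
        rw [pow_two, Matrix.mul_apply]
        refine Finset.sum_congr rfl fun y _ => ?_
        simp only [normAdjMatrix_apply, G.adj_comm y x]
        split_ifs
        · rw [mul_comm (√(G.degree y : ℝ))⁻¹, mul_mul_mul_comm, ← mul_inv, ← mul_inv,
            Real.mul_self_sqrt (by positivity), Real.mul_self_sqrt (by positivity)]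
        · simp
    _ ≤ ∑ y, if G.Adj x y then (G.degree x : ℝ)⁻¹ * δ⁻¹ else 0 := by
        refine Finset.sum_le_sum fun y _ => ?_
        split_ifs with h
        · have := hdeg y x h.symm
          gcongr
        · exact le_rfl
    _ = δ⁻¹ := by
        rw [← Finset.sum_filter, ← neighborFinset_eq_filter, Finset.sum_const,
          card_neighborFinset_eq_degree, nsmul_eq_mul]
        field_simp

lemma exists_eigenvalues_normAdjMatrix_eq_one [DecidableEq V] {x y : V} (h : G.Adj x y) :
    ∃ i, G.isHermitian_normAdjMatrix.eigenvalues i = 1 := by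
  refine G.isHermitian_normAdjMatrix.exists_eigenvalues_eq_of_mulVec
    (v := fun z => √(G.degree z)) ?_ ?_
  · intro h0
    have hx : 0 < G.degree x := G.degree_pos_iff_exists_adj x |>.2 ⟨y, h⟩
    have := congrFun h0 x
    simp only [Pi.zero_apply] at this
    rw [Real.sqrt_eq_zero (by positivity)] at this
    exact hx.ne' (by exact_mod_cast this)
  · ext z
    rw [one_smul, Matrix.mulVec, dotProduct]
    calc ∑ w, G.normAdjMatrix z w * √(G.degree w)
        = ∑ w, if G.Adj z w then (√(G.degree z))⁻¹ else 0 := by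
          refine Finset.sum_congr rfl fun w _ => ?_
          rw [normAdjMatrix_apply]
          split_ifs with hzw
          · have hw : 0 < G.degree w := G.degree_pos_iff_exists_adj w |>.2 ⟨z, hzw.symm⟩
            have : √(G.degree w : ℝ) ≠ 0 := by positivity
            field_simp
          · simp
      _ = √(G.degree z) := by
          rw [← Finset.sum_filter, ← neighborFinset_eq_filter, Finset.sum_const,
            card_neighborFinset_eq_degree, nsmul_eq_mul, ← div_eq_mul_inv, Real.div_sqrt]

/-- A lower bound for the number of closed walks of length `2k` without repeated vertices. -/
lemma half_mul_pow_le_card_injective [DecidableEq V] {δ : ℝ} (hδ : 0 < δ)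
    (hdeg : ∀ x y, G.Adj x y → δ ≤ G.degree x)
    {k : ℕ} (hk : 2 ≤ k) [NeZero (2 * k)] {x y : V}
    (hxy : G.Adj x y) (hcard : (16 * k ^ 2 : ℝ) ^ k * Fintype.card V ≤ δ ^ k) :
    δ ^ (2 * k) / 2 ≤ ((Finset.univ.filter fun f : Fin (2 * k) → V =>
      Function.Injective f ∧ ∀ i, G.Adj (f i) (f (i + 1))).card : ℝ) := by
  set N := G.normAdjMatrix with hN
  have hH : N.IsHermitian := G.isHermitian_normAdjMatrix
  set W : (Fin (2 * k) → V) → ℝ := fun f => ∏ l, N (f l) (f (l + 1)) with hW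
  have hW0 : ∀ f, 0 ≤ W f := fun f => Finset.prod_nonneg fun l _ => G.normAdjMatrix_nonneg _ _
  obtain ⟨K, rfl⟩ : ∃ K, k = K + 1 := ⟨k - 1, by omega⟩
  set M : ℝ := 16 * ((K + 1 : ℕ) : ℝ) ^ 2 with hM
  have hMpos : 0 < M := by positivity
  have hδk : 0 < δ ^ (K + 1) := by positivity
  have hone : 1 ≤ (N ^ (2 * (K + 1))).trace := by
    obtain ⟨i, hi⟩ := exists_eigenvalues_normAdjMatrix_eq_one hxy
    rw [hH.trace_pow_eq_sum]
    calc (1 : ℝ) = hH.eigenvalues i ^ (2 * (K + 1)) := by rw [hi, one_pow]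
      _ ≤ _ := Finset.single_le_sum (f := fun i => hH.eigenvalues i ^ (2 * (K + 1)))
        (fun j _ => (even_two_mul _).pow_nonneg _) (Finset.mem_univ i)
  have hlower : δ⁻¹ * (N ^ (2 * K)).trace ≤ 2 / M * (N ^ (2 * (K + 1))).trace := by
    have hterm : ∀ t : ℝ, 0 ≤ t → δ⁻¹ * t ^ K ≤ M⁻¹ * t ^ (K + 1) + M ^ K / δ ^ (K + 1) := by
      intro t ht
      rcases le_total (M / δ) t with h | h
      · have h' : δ⁻¹ ≤ M⁻¹ * t := by
          calc δ⁻¹ = M⁻¹ * (M / δ) := by field_simp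
            _ ≤ M⁻¹ * t := by gcongr
        calc δ⁻¹ * t ^ K ≤ M⁻¹ * t * t ^ K := by gcongr
          _ = M⁻¹ * t ^ (K + 1) := by ring
          _ ≤ _ := le_add_of_nonneg_right (by positivity)
      · calc δ⁻¹ * t ^ K ≤ δ⁻¹ * (M / δ) ^ K := by gcongr
          _ = M ^ K / δ ^ (K + 1) := by rw [div_pow, pow_succ]; field_simp
          _ ≤ _ := le_add_of_nonneg_left (by positivity)
    calc δ⁻¹ * (N ^ (2 * K)).trace
        ≤ M⁻¹ * (N ^ (2 * (K + 1))).trace + Fintype.card V * (M ^ K / δ ^ (K + 1)) := by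
          rw [hH.trace_pow_eq_sum, hH.trace_pow_eq_sum, Finset.mul_sum, Finset.mul_sum,
            ← nsmul_eq_mul, Fintype.card, ← Finset.sum_const, ← Finset.sum_add_distrib]
          refine Finset.sum_le_sum fun i _ => ?_
          rw [pow_mul, pow_mul]
          exact hterm _ (sq_nonneg _)
      _ ≤ M⁻¹ * (N ^ (2 * (K + 1))).trace + M⁻¹ * 1 := by
          refine add_le_add_right ?_ _
          rw [mul_one, mul_div_assoc', div_le_iff₀ hδk, inv_mul_eq_div, le_div_iff₀ hMpos]
          calc Fintype.card V * M ^ K * M = M ^ (K + 1) * Fintype.card V := by ring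
            _ ≤ _ := hcard
      _ ≤ M⁻¹ * (N ^ (2 * (K + 1))).trace + M⁻¹ * (N ^ (2 * (K + 1))).trace := by gcongr
      _ = _ := by ring
  have hpair : ∀ p : Fin (2 * (K + 1)) × Fin (2 * (K + 1)), p.1 < p.2 →
      ∑ f : Fin (2 * (K + 1)) → V with f p.1 = f p.2, W f ≤
        2 / M * (N ^ (2 * (K + 1))).trace := by
    rintro ⟨i, j⟩ hij
    rw [Matrix.sum_filter_eq_prod N hij]
    have hj := j.2
    have hij' : (i : ℕ) < j := hij
    exact (hH.sum_pow_apply_self_mul_le (fun x => by simp [hN, normAdjMatrix_apply])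
      (normAdjMatrix_sq_apply_self_le hδ hdeg) (by positivity) (by omega) (by omega)
      (by omega)).trans hlower
  have htotal : (N ^ (2 * (K + 1))).trace = ∑ f, W f := by
    have := Matrix.trace_prod_range (fun _ => N) (2 * (K + 1))
    simpa using this
  have hnoninj : ∑ f with ¬ Function.Injective f, W f ≤ (N ^ (2 * (K + 1))).trace / 2 := by
    calc ∑ f with ¬ Function.Injective f, W f
        ≤ ∑ f, ∑ p : Fin (2 * (K + 1)) × Fin (2 * (K + 1)) with p.1 < p.2,
            if f p.1 = f p.2 then W f else 0 := by
          rw [Finset.sum_filter]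
          refine Finset.sum_le_sum fun f _ => ?_
          have hnn : ∀ p ∈ Finset.univ.filter
              fun p : Fin (2 * (K + 1)) × Fin (2 * (K + 1)) => p.1 < p.2,
              0 ≤ if f p.1 = f p.2 then W f else 0 := fun p _ => by
            split_ifs
            exacts [hW0 f, le_rfl]
          split_ifs with h
          · exact Finset.sum_nonneg hnn
          · obtain ⟨i, j, hf, hij⟩ : ∃ i j, f i = f j ∧ i < j := by
              simp only [Function.Injective, not_forall] at h
              obtain ⟨i, j, hf, hne⟩ := h
              rcases lt_or_gt_of_ne hne with h | h
              exacts [⟨i, j, hf, h⟩, ⟨j, i, hf.symm, h⟩]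
            have := Finset.single_le_sum hnn (a := (i, j)) (by simpa using hij)
            simpa [hf] using this
      _ = ∑ p : Fin (2 * (K + 1)) × Fin (2 * (K + 1)) with p.1 < p.2,
            ∑ f : Fin (2 * (K + 1)) → V with f p.1 = f p.2, W f := by
          rw [Finset.sum_comm]
          simp_rw [Finset.sum_filter]
      _ ≤ ∑ p : Fin (2 * (K + 1)) × Fin (2 * (K + 1)) with p.1 < p.2,
            2 / M * (N ^ (2 * (K + 1))).trace :=
          Finset.sum_le_sum fun p hp => hpair p (Finset.mem_filter.1 hp).2
      _ ≤ ∑ p : Fin (2 * (K + 1)) × Fin (2 * (K + 1)), 2 / M * (N ^ (2 * (K + 1))).trace :=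
          Finset.sum_le_sum_of_subset_of_nonneg (Finset.filter_subset _ _) fun _ _ _ => by
            positivity
      _ = (N ^ (2 * (K + 1))).trace / 2 := by
          rw [Finset.sum_const, Finset.card_univ, Fintype.card_prod, Fintype.card_fin,
            nsmul_eq_mul, hM]
          push_cast
          field_simp
          norm_num
  have hinj : 1 / 2 ≤ ∑ f with Function.Injective f, W f := by
    have := Finset.sum_filter_add_sum_filter_not Finset.univ Function.Injective W
    linarith
  have hcount : ∑ f with Function.Injective f, W f ≤
      ((Finset.univ.filter fun f : Fin (2 * (K + 1)) → V =>
        Function.Injective f ∧ ∀ i, G.Adj (f i) (f (i + 1))).card : ℝ) *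
        (δ⁻¹) ^ (2 * (K + 1)) := by
    rw [← nsmul_eq_mul, ← Finset.sum_const, ← Finset.filter_filter,
      Finset.sum_filter (fun f : Fin (2 * (K + 1)) → V => ∀ i, G.Adj (f i) (f (i + 1)))]
    refine Finset.sum_le_sum fun f _ => ?_
    split_ifs with h
    · calc W f ≤ ∏ _l : Fin (2 * (K + 1)), δ⁻¹ :=
          Finset.prod_le_prod (fun _ _ => G.normAdjMatrix_nonneg _ _)
            fun _ _ => normAdjMatrix_le hδ hdeg _ _
        _ = _ := by simp
    · obtain ⟨i, hi⟩ := not_forall.1 h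
      exact (Finset.prod_eq_zero (Finset.mem_univ i) (by
        rw [hN, normAdjMatrix_apply, if_neg hi])).le
  have := hinj.trans hcount
  rw [inv_pow, ← div_eq_mul_inv, le_div_iff₀ (by positivity)] at this
  linarith

end NormAdjMatrix

/-- A graph contains a nonempty subgraph whose nonisolated vertices have degree at least half
the average degree of the graph. -/
lemma exists_le_forall_adj_le_degree {V : Type*} [Fintype V] [DecidableEq V] (G : SimpleGraph V)
    [DecidableRel G.Adj] (hG : 0 < G.edgeFinset.card) :
    ∃ (H : SimpleGraph V) (_ : DecidableRel H.Adj), H ≤ G ∧ (∃ x y, H.Adj x y) ∧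
      ∀ x y, H.Adj x y → (G.edgeFinset.card : ℝ) / Fintype.card V ≤ H.degree x := by
  set δ : ℝ := (G.edgeFinset.card : ℝ) / Fintype.card V with hδ
  have hV : Nonempty V := by
    obtain ⟨e, -⟩ := Finset.card_pos.1 hG
    exact ⟨e.out.1⟩
  have hcard : (0 : ℝ) < Fintype.card V := by exact_mod_cast Fintype.card_pos
  have hδ0 : 0 < δ := div_pos (by exact_mod_cast hG) hcard
  set a : V → V → ℝ := fun u v => if G.Adj u v then 1 else 0 with ha
  have hsymm : ∀ u v, a u v = a v u := fun u v => by simp only [ha, G.adj_comm]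
  set φ : Finset V → ℝ := fun S => ∑ u ∈ S, ∑ v ∈ S, a u v - 2 * δ * S.card with hφ
  have hdeg : ∀ v (S : Finset V), ∑ u ∈ S, a v u = (S.filter (G.Adj v)).card := fun v S => by
    simp [ha]
  have huniv : φ Finset.univ = 0 := by
    have h := G.sum_degrees_eq_twice_card_edges
    have h' : ∑ u, ∑ v, a u v = 2 * G.edgeFinset.card := by
      simp_rw [hdeg, ← neighborFinset_eq_filter, card_neighborFinset_eq_degree]
      exact_mod_cast h
    rw [hφ]
    simp only
    rw [h', Finset.card_univ, hδ]
    field_simp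
    ring
  obtain ⟨S, hS, hmax⟩ := Finset.exists_max_image
    (Finset.univ.filter fun S : Finset V => S.Nonempty) φ ⟨Finset.univ, by simp⟩
  replace hS : S.Nonempty := (Finset.mem_filter.1 hS).2
  replace hmax : ∀ T : Finset V, T.Nonempty → φ T ≤ φ S := fun T hT => hmax T (by simpa using hT)
  have hS0 : 0 ≤ φ S := huniv ▸ hmax _ Finset.univ_nonempty
  have hmin : ∀ v ∈ S, δ ≤ ((S.filter (G.Adj v)).card : ℝ) := by
    intro v hv
    obtain ⟨T, hvT, rfl⟩ : ∃ T, v ∉ T ∧ insert v T = S :=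
      ⟨S.erase v, Finset.notMem_erase v S, Finset.insert_erase hv⟩
    have hself : a v v = 0 := by simp [ha]
    have hins : φ (insert v T) = φ T + 2 * ((insert v T).filter (G.Adj v)).card - 2 * δ := by
      rw [← hdeg]
      simp only [hφ]
      rw [Finset.card_insert_of_notMem hvT, Finset.sum_insert hvT]
      simp_rw [Finset.sum_insert hvT, Finset.sum_add_distrib, hself]
      simp_rw [hsymm _ v]
      push_cast
      ring
    rcases T.eq_empty_or_nonempty with rfl | hT
    · have h1 : φ ∅ = 0 := by simp [hφ]
      have h2 : ((insert v ∅ : Finset V).filter (G.Adj v)).card = 0 := by simp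
      rw [hins, h1, h2] at hS0
      norm_num at hS0
      linarith
    · have := hmax T hT
      linarith
  let H : SimpleGraph V :=
    { Adj := fun u v => G.Adj u v ∧ u ∈ S ∧ v ∈ S
      symm := ⟨fun u v h => ⟨h.1.symm, h.2.2, h.2.1⟩⟩
      loopless := ⟨fun u h => G.loopless.irrefl u h.1⟩ }
  have hdec : DecidableRel H.Adj := fun u v => inferInstanceAs (Decidable (_ ∧ _))
  have hH : ∀ u v, H.Adj u v ↔ G.Adj u v ∧ u ∈ S ∧ v ∈ S := fun _ _ => Iff.rfl
  refine ⟨H, hdec, fun u v h => h.1, ?_, fun x y hxy => ?_⟩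
  · obtain ⟨v, hv⟩ := hS
    have h : 0 < (S.filter (G.Adj v)).card := by exact_mod_cast hδ0.trans_le (hmin v hv)
    obtain ⟨u, hu⟩ := Finset.card_pos.1 h
    rw [Finset.mem_filter] at hu
    exact ⟨v, u, hu.2, hv, hu.1⟩
  · refine (hmin x hxy.2.1).trans_eq ?_
    rw [← card_neighborFinset_eq_degree, neighborFinset_eq_filter]
    congr 2
    ext u
    simp [hH, hxy.2.1, and_comm]

lemma card_injective_le_mul_countCopiesOfCycle {V : Type*} [Fintype V] [DecidableEq V]
    (G : SimpleGraph V) [DecidableRel G.Adj] {n : ℕ} (hn : 2 ≤ n) [NeZero n] :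
    (Finset.univ.filter fun f : Fin n → V =>
      Function.Injective f ∧ ∀ i, G.Adj (f i) (f (i + 1))).card ≤
      n ^ n * countCopiesOfCycle n G := by
  classical
  have hcopy : ∀ f : Fin n → V, Function.Injective f ∧ (∀ i, G.Adj (f i) (f (i + 1))) →
      ∃ H : G.Subgraph, Nonempty (H.coe ≃g cycleGraph n) ∧ ∀ i, f i ∈ H.verts := by
    rintro f ⟨hf, hadj⟩
    obtain ⟨m, rfl⟩ := Nat.exists_eq_add_of_le' hn
    let F : cycleGraph (m + 2) →g G :=
      { toFun := f
        map_rel' := by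
          intro u v huv
          rcases cycleGraph_adj.1 huv with h | h
          · rw [sub_eq_iff_eq_add'.1 h]
            convert (hadj v).symm using 2
          · rw [sub_eq_iff_eq_add'.1 h]
            convert hadj u using 2 }
    let Φ : Copy (cycleGraph (m + 2)) G := ⟨F, hf⟩
    exact ⟨Φ.toSubgraph, ⟨Φ.isoToSubgraph.symm⟩, fun i => ⟨i, trivial, rfl⟩⟩
  choose! Ψ hΨ hmem using hcopy
  rw [countCopiesOfCycle, Set.ncard_eq_toFinset_card']
  refine Finset.card_le_mul_card_image_of_maps_to (f := Ψ) (fun f hf => ?_) _ fun H hH => ?_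
  · simpa using hΨ f (Finset.mem_filter.1 hf).2
  · obtain ⟨e⟩ : Nonempty (H.coe ≃g cycleGraph n) := by simpa using hH
    have hc : H.verts.toFinset.card = n := by
      rw [Set.toFinset_card, Fintype.card_congr e.toEquiv, Fintype.card_fin]
    calc _ ≤ (Fintype.piFinset fun _ : Fin n => H.verts.toFinset).card := by
          refine Finset.card_le_card fun f hf => ?_
          simp only [Finset.mem_filter, Finset.mem_univ, true_and] at hf
          rw [Fintype.mem_piFinset]
          intro i
          rw [Set.mem_toFinset, ← hf.2]
          exact hmem f hf.1 i
      _ = n ^ n := by rw [Fintype.card_piFinset_const, hc]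

end SimpleGraph

/-- Supersaturation for even cycles: for every `k ≥ 2` there are constants `c, C > 0`
such that every `n`-vertex graph with `m ≥ C·n^(1+1/k)` edges contains at least
`c·(m/n)^(2k)` copies of `C_{2k}`. -/
theorem supersaturation_C2k (k : ℕ) (hk : 2 ≤ k) :
    ∃ c C : ℝ, 0 < c ∧ 0 < C ∧
      ∀ (V : Type) [Fintype V] [DecidableEq V] (G : SimpleGraph V) [DecidableRel G.Adj],
        (G.edgeFinset.card : ℝ) ≥ C * (Fintype.card V : ℝ) ^ (1 + 1 / (k : ℝ)) →
        (countCopiesOfCycle (2 * k) G : ℝ) ≥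
          c * ((G.edgeFinset.card : ℝ) / (Fintype.card V : ℝ)) ^ (2 * k) := by
  have : NeZero (2 * k) := ⟨by omega⟩
  have hk0 : (0 : ℝ) < k := by exact_mod_cast (by omega : 0 < k)
  refine ⟨((2 * k : ℕ) ^ (2 * k) * 2 : ℝ)⁻¹, 16 * k ^ 2, by push_cast; positivity,
    by positivity, ?_⟩
  intro V _ _ G _ hm
  rcases G.edgeFinset.card.eq_zero_or_pos with h0 | hpos
  · rw [h0]
    simp [show k ≠ 0 by omega]
  obtain ⟨H, _, hle, ⟨x, y, hxy⟩, hdeg⟩ := G.exists_le_forall_adj_le_degree hpos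
  have hV : (0 : ℝ) < Fintype.card V := by exact_mod_cast Fintype.card_pos_iff.2 ⟨x⟩
  set δ : ℝ := (G.edgeFinset.card : ℝ) / Fintype.card V with hδ
  have hδ0 : 0 < δ := div_pos (by exact_mod_cast hpos) hV
  have hδk : (16 * k ^ 2 : ℝ) ^ k * Fintype.card V ≤ δ ^ k := by
    have h1 : 16 * (k : ℝ) ^ 2 * (Fintype.card V : ℝ) ^ (1 / (k : ℝ)) ≤ δ := by
      rw [hδ, le_div_iff₀ hV]
      rw [Real.rpow_add hV, Real.rpow_one] at hm
      linarith
    have h2 := pow_le_pow_left₀ (by positivity) h1 k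
    rwa [mul_pow _ ((Fintype.card V : ℝ) ^ (1 / (k : ℝ))), one_div,
      Real.rpow_inv_natCast_pow hV.le (by omega)] at h2
  have hcount := half_mul_pow_le_card_injective hδ0 hdeg hk hxy hδk
  have hmono : (Finset.univ.filter fun f : Fin (2 * k) → V =>
      Function.Injective f ∧ ∀ i, H.Adj (f i) (f (i + 1))).card ≤
      (Finset.univ.filter fun f : Fin (2 * k) → V =>
        Function.Injective f ∧ ∀ i, G.Adj (f i) (f (i + 1))).card :=
    Finset.card_le_card (Finset.monotone_filter_right _ fun f _ hf =>
      ⟨hf.1, fun i => hle (hf.2 i)⟩)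
  have hfinal : δ ^ (2 * k) / 2 ≤ ((2 * k : ℕ) : ℝ) ^ (2 * k) * countCopiesOfCycle (2 * k) G := by
    refine hcount.trans ?_
    exact_mod_cast hmono.trans (G.card_injective_le_mul_countCopiesOfCycle (by omega))
  rw [ge_iff_le, inv_mul_le_iff₀ (by positivity)]
  linarith
end

section
/- For every integer k ≥ 2 there is a constant C_k > 0 (depending only on k) such that the following holds. Let G be a finite simple graph containing no copy of C_{2k}, and let A, B ⊆ V(G) be vertex subsets, not necessarily disjoint. Then e(A,B) ≤ C_k·(|A| + |B| + (|A|·|B|)^((k+1)/(2k))). -/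
open SimpleGraph

/-- The number of edges of `G` with one endpoint in `A` and the other in `B`. -/
noncomputable def eCount {V : Type*} (G : SimpleGraph V) (A B : Set V) : ℕ :=
  {e ∈ G.edgeSet | ∃ u ∈ A, ∃ v ∈ B, e = s(u, v)}.ncard

section EvenCycles

variable {V : Type*} {G : SimpleGraph V}

/-- A duplicate-free list of consecutively adjacent vertices whose last vertex is adjacent to its
first one is a cycle. -/
theorem cycleGraph_isContained_of_list {l : List V} {n : ℕ} (hl : l.length = n)
    (hc : l.IsChain G.Adj) (hnd : l.Nodup)
    (hclose : ∀ a ∈ l.getLast?, ∀ b ∈ l.head?, G.Adj a b) : cycleGraph n ⊑ G := by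
  rcases n with _ | n
  · exact IsContained.of_isEmpty
  have hstep : ∀ u v : Fin (n + 1), v = u + 1 →
      G.Adj (l[u.val]'(by omega)) (l[v.val]'(by omega)) := by
    intro u v huv
    rcases Nat.lt_or_ge (u.val + 1) (n + 1) with h | h
    · have hv : v.val = u.val + 1 := by
        rw [huv, Fin.val_add_one_of_lt]
        rw [Fin.lt_def, Fin.val_last]
        omega
      simp only [hv]
      exact List.isChain_iff_getElem.1 hc _ _
    · have hu : u = Fin.last n := Fin.ext (by rw [Fin.val_last]; omega)
      subst hu
      have hv : v = 0 := by rw [huv, Fin.last_add_one]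
      subst hv
      apply hclose
      · simp [List.getLast?_eq_getElem?, hl]
      · simp [List.head?_eq_getElem?, hl]
  refine ⟨⟨⟨fun u => l[u.val]'(by omega), ?_⟩, ?_⟩⟩
  · intro u v huv
    rw [cycleGraph_eq_circulantGraph, circulantGraph, fromRel_adj] at huv
    simp only [Set.mem_singleton_iff, sub_eq_iff_eq_add'] at huv
    rcases huv.2 with h | h
    · exact (hstep v u h).symm
    · exact hstep u v h
  · intro u v huv
    exact Fin.ext ((hnd.getElem_inj_iff).1 huv)

open Classical in
/-- In a bipartite graph of large minimum degree, alternating paths of any short prescribed odd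
length can be grown from a vertex while avoiding a short list of vertices. -/
theorem exists_alternating_path {X Y : Finset V} {F : List V} {N : ℕ}
    (hX : ∀ x ∈ X, N < (Y.filter (G.Adj x)).card) (hY : ∀ y ∈ Y, N < (X.filter (G.Adj y)).card)
    (hF : ∀ f ∈ F, f ∉ Y) {P : V → Prop}
    (hP : ∀ y ∈ Y, ∀ x ∈ X, ∀ x' ∈ X, G.Adj y x → G.Adj y x' → P x → P x')
    {y x₀ : V} (hy : y ∈ Y) (hx₀ : x₀ ∈ X) (hyx₀ : G.Adj y x₀) (hPx₀ : P x₀) (j : ℕ)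
    (hj : 2 * j + 2 + F.length ≤ N) :
    ∃ x Q, x ∈ X ∧ P x ∧ x ∉ F ∧ (x :: Q).IsChain G.Adj ∧ (x :: Q).Nodup ∧
      Q.length = 2 * j + 1 ∧ (∀ q ∈ Q, (q ∈ X ∨ q ∈ Y) ∧ q ∉ F) ∧ Q.getLast? = some y := by
  have hext : ∀ (S : Finset V) (L : List V), L.length < S.card → ∃ s ∈ S, s ∉ L := by
    intro S L hSL
    obtain ⟨s, hs, hsL⟩ := Finset.exists_mem_notMem_of_card_lt_card
      (lt_of_le_of_lt L.toFinset_card_le hSL)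
    exact ⟨s, hs, by simpa using hsL⟩
  induction j with
  | zero =>
    obtain ⟨x, hx, hxF⟩ := hext _ F (lt_of_le_of_lt (by omega) (hY y hy))
    rw [Finset.mem_filter] at hx
    refine ⟨x, [y], hx.1, hP y hy x₀ hx₀ x hx.1 hyx₀ hx.2 hPx₀, hxF, ?_, ?_, rfl, ?_, rfl⟩
    · simpa using hx.2.symm
    · simpa using hx.2.ne'
    · simpa using ⟨Or.inr hy, fun h => hF y h hy⟩
  | succ j ih =>
    obtain ⟨x, Q, hx, hPx, hxF, hc, hnd, hlen, hQ, hlast⟩ := ih (by omega)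
    obtain ⟨y₁, hy₁, hy₁Q⟩ := hext _ (x :: Q)
      (lt_of_le_of_lt (by rw [List.length_cons]; omega) (hX x hx))
    rw [Finset.mem_filter] at hy₁
    obtain ⟨x₁, hx₁, hx₁Q⟩ := hext _ (x :: Q ++ F)
      (lt_of_le_of_lt (by rw [List.length_append, List.length_cons]; omega) (hY y₁ hy₁.1))
    rw [Finset.mem_filter] at hx₁
    simp only [List.mem_append, not_or] at hx₁Q
    refine ⟨x₁, y₁ :: x :: Q, hx₁.1, hP y₁ hy₁.1 x hx x₁ hx₁.1 hy₁.2.symm hx₁.2 hPx, hx₁Q.2,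
      ?_, ?_, by simp [hlen]; ring, ?_, ?_⟩
    · exact .cons_cons hx₁.2.symm (.cons_cons hy₁.2.symm hc)
    · refine List.nodup_cons.2 ⟨?_, List.nodup_cons.2 ⟨hy₁Q, hnd⟩⟩
      rw [List.mem_cons, not_or]
      exact ⟨hx₁.2.ne', hx₁Q.1⟩
    · intro q hq
      rcases List.mem_cons.1 hq with rfl | hq
      · exact ⟨Or.inr hy₁.1, fun h => hF q h hy₁.1⟩
      rcases List.mem_cons.1 hq with rfl | hq
      · exact ⟨Or.inl hx, hxF⟩
      · exact hQ q hq
    · cases Q with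
      | nil => simp at hlast
      | cons a Q => simpa using hlast

theorem level_iterate_add {lv : V → ℕ} {par : V → V} {i : ℕ}
    (hpar : ∀ v, 0 < lv v → lv v ≤ i → lv (par v) + 1 = lv v) {v : V} (hv : lv v = i) {t : ℕ}
    (ht : t ≤ i) : lv (par^[t] v) + t = i := by
  induction t with
  | zero => simpa using hv
  | succ t ih =>
    have h1 := ih (by omega)
    have h2 := hpar (par^[t] v) (by omega) (by omega)
    rw [Function.iterate_succ_apply']
    omega

/-- Two branches of a rooted tree that merge at height `s + 1`, together with a path
joining their ends from outside the tree, form a cycle. -/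
theorem cycleGraph_isContained_of_branches {lv : V → ℕ} {par : V → V} {i : ℕ}
    (hpar : ∀ v, 0 < lv v → lv v ≤ i → G.Adj v (par v) ∧ lv (par v) + 1 = lv v)
    {x z y : V} {Q : List V} {s : ℕ} (hs : s < i) (hx : lv x = i) (hz : lv z = i)
    (hne : par^[s] x ≠ par^[s] z) (heq : par^[s + 1] x = par^[s + 1] z)
    (hc : (z :: Q).IsChain G.Adj) (hnd : (z :: Q).Nodup) (hQ : ∀ q ∈ Q, i ≤ lv q)
    (hxQ : x ∉ Q) (hlast : Q.getLast? = some y) (hyx : G.Adj y x) :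
    cycleGraph (2 * s + 3 + Q.length) ⊑ G := by
  have hlv : ∀ v, lv v = i → ∀ t ≤ i, lv (par^[t] v) + t = i :=
    fun v hv t ht => level_iterate_add (fun u h h' => (hpar u h h').2) hv ht
  have hadj : ∀ v, lv v = i → ∀ t < i, G.Adj (par^[t] v) (par^[t + 1] v) := by
    intro v hv t ht
    have h1 := hlv v hv t ht.le
    rw [Function.iterate_succ_apply']
    exact (hpar _ (by omega) (by omega)).1
  have hne' : ∀ t ≤ s, par^[t] x ≠ par^[t] z := by
    intro t ht h
    apply hne
    rw [show s = (s - t) + t by omega, Function.iterate_add_apply, h, ← Function.iterate_add_apply]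
  have hchain : ∀ v, lv v = i → ∀ n ≤ i + 1, (List.iterate par v n).IsChain G.Adj := by
    intro v hv n hn
    rw [List.isChain_iff_getElem]
    intro t ht
    rw [List.length_iterate] at ht
    rw [List.getElem_iterate, List.getElem_iterate]
    exact hadj v hv t (by omega)
  have hnodup : ∀ v, lv v = i → ∀ n ≤ i + 1, (List.iterate par v n).Nodup := by
    intro v hv n hn
    rw [List.nodup_iff_injective_getElem]
    intro a b hab
    have ha := a.2
    have hb := b.2
    have hlen := List.length_iterate par v n
    simp only [List.getElem_iterate] at hab
    have h1 := hlv v hv a (by omega)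
    have h2 := hlv v hv b (by omega)
    rw [hab] at h1
    exact Fin.ext (by omega)
  rw [List.isChain_cons] at hc
  rw [List.nodup_cons] at hnd
  refine cycleGraph_isContained_of_list
    (l := List.iterate par x (s + 2) ++ ((List.iterate par z (s + 1)).reverse ++ Q)) ?_ ?_ ?_ ?_
  · simp only [List.length_append, List.length_reverse, List.length_iterate]
    omega
  · refine (hchain x hx _ (by omega)).append (List.IsChain.append ?_ hc.2 ?_) ?_
    · rw [List.isChain_reverse]
      exact (hchain z hz _ (by omega)).imp fun a b h => h.symm
    · intro a ha b hb
      have : a = z := by simpa [List.iterate, eq_comm] using ha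
      rw [this]
      exact hc.1 b hb
    · intro a ha b hb
      have ha' : par^[s + 1] x = a := by
        rw [List.getLast?_eq_getElem?, List.length_iterate,
          List.getElem?_iterate _ _ _ _ (by omega)] at ha
        simpa using ha
      have hb' : par^[s] z = b := by
        rw [List.head?_append, List.head?_reverse, List.getLast?_eq_getElem?, List.length_iterate,
          Nat.add_sub_cancel, List.getElem?_iterate _ _ _ _ (by omega)] at hb
        simpa using hb
      rw [← ha', ← hb', heq]
      exact (hadj z hz s hs).symm
  · refine (hnodup x hx _ (by omega)).append
      (((List.nodup_reverse).2 (hnodup z hz _ (by omega))).append hnd.2 ?_) ?_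
    · intro a ha haQ
      rw [List.mem_reverse, List.mem_iterate] at ha
      obtain ⟨t, ht, rfl⟩ := ha
      have h1 := hlv z hz t (by omega)
      have h2 := hQ _ haQ
      obtain rfl : t = 0 := by omega
      exact hnd.1 haQ
    · intro a ha ha'
      rw [List.mem_iterate] at ha
      obtain ⟨t, ht, rfl⟩ := ha
      have h1 := hlv x hx t (by omega)
      rw [List.mem_append, List.mem_reverse, List.mem_iterate] at ha'
      rcases ha' with ⟨t', ht', h⟩ | haQ
      · have h2 := hlv z hz t' (by omega)
        rw [h] at h1
        obtain rfl : t = t' := by omega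
        exact hne' t (by omega) h
      · have h2 := hQ _ haQ
        obtain rfl : t = 0 := by omega
        exact hxQ haQ
  · intro a ha b hb
    have ha' : y = a := by
      rw [← List.append_assoc, List.getLast?_append, hlast] at ha
      simpa using ha
    have hb' : x = b := by simpa [List.iterate] using hb
    rw [← ha', ← hb']
    exact hyx

open Classical in
/-- If two consecutive levels of a rooted tree of depth at most `k` span a bipartite
graph of minimum degree above `2k`, then there is a cycle of length `2k`. -/
theorem cycleGraph_isContained_of_levels_s2 {k i : ℕ} {lv : V → ℕ} {par : V → V}
    (hpar : ∀ v, 0 < lv v → lv v ≤ i → G.Adj v (par v) ∧ lv (par v) + 1 = lv v)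
    (hroot : ∀ u v, lv u = 0 → lv v = 0 → u = v) (hik : i + 1 ≤ k) {X Y : Finset V}
    (hXlv : ∀ x ∈ X, lv x = i) (hYlv : ∀ y ∈ Y, lv y = i + 1) (hYne : Y.Nonempty)
    (hX : ∀ x ∈ X, 2 * k < (Y.filter (G.Adj x)).card)
    (hY : ∀ y ∈ Y, 2 * k < (X.filter (G.Adj y)).card) : cycleGraph (2 * k) ⊑ G := by
  let p : ℕ → Prop := fun s => ∃ y ∈ Y, ∃ x ∈ X, ∃ z ∈ X, G.Adj y x ∧ G.Adj y z ∧
    par^[s] x ≠ par^[s] z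
  have hp0 : p 0 := by
    obtain ⟨y, hy⟩ := hYne
    obtain ⟨x, hx, z, hz, hxz⟩ := Finset.one_lt_card.1 
      (lt_of_le_of_lt (by omega : 1 ≤ 2 * k) (hY y hy))
    rw [Finset.mem_filter] at hx hz
    exact ⟨y, hy, x, hx.1, z, hz.1, hx.2, hz.2, hxz⟩
  have hlv : ∀ v ∈ X, ∀ t ≤ i, lv (par^[t] v) + t = i :=
    fun v hv t ht => level_iterate_add (fun u h h' => (hpar u h h').2) (hXlv v hv) ht
  have hpi : ¬ p i := by
    rintro ⟨y, -, x, hx, z, hz, -, -, h⟩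
    have h1 := hlv x hx i le_rfl
    have h2 := hlv z hz i le_rfl
    exact h (hroot _ _ (by omega) (by omega))
  obtain ⟨s, hsi, hs, hs'⟩ : ∃ s < i, p s ∧ ¬ p (s + 1) := by
    by_contra! hcon
    have : ∀ s ≤ i, p s := by
      intro s
      induction s with
      | zero => exact fun _ => hp0
      | succ s ih => exact fun h => hcon s (by omega) (ih (by omega))
    exact hpi (this i le_rfl)
  obtain ⟨y, hy, x, hx, z, hz, hyx, hyz, hxz⟩ := hs
  have hmerge : ∀ y ∈ Y, ∀ x ∈ X, ∀ z ∈ X, G.Adj y x → G.Adj y z →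
      par^[s + 1] x = par^[s + 1] z := by
    intro y hy x hx z hz hyx hyz
    by_contra h
    exact hs' ⟨y, hy, x, hx, z, hz, hyx, hyz, h⟩
  have hXY : ∀ x ∈ X, x ∉ Y := by
    intro x hx hxY
    have h1 := hXlv x hx
    have h2 := hYlv x hxY
    omega
  obtain ⟨w, Q, hw, hPw, hwF, hc, hnd, hlen, hQ, hlast⟩ := exists_alternating_path
    (F := [x, z]) (P := fun v => par^[s + 1] x = par^[s + 1] v) hX hY
    (by simpa using ⟨hXY x hx, hXY z hz⟩)
    (fun y hy a ha b hb hya hyb h => h.trans (hmerge y hy a ha b hb hya hyb)) hy hx hyx rfl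
    (k - s - 2) (by simp only [List.length_cons, List.length_nil]; omega)
  have hQlv : ∀ q ∈ Q, i ≤ lv q := by
    intro q hq
    rcases (hQ q hq).1 with h | h
    · exact (hXlv q h).ge
    · have := hYlv q h
      omega
  have hk : 2 * k = 2 * s + 3 + Q.length := by omega
  rw [hk]
  by_cases hxw : par^[s] x = par^[s] w
  · exact cycleGraph_isContained_of_branches hpar hsi (hXlv z hz) (hXlv w hw)
      (fun h => hxz (hxw.trans h.symm)) ((hmerge y hy x hx z hz hyx hyz).symm.trans hPw) hc hnd hQlv
      (fun h => (hQ z h).2 (by simp)) hlast hyz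
  · exact cycleGraph_isContained_of_branches hpar hsi (hXlv x hx) (hXlv w hw) hxw hPw hc hnd hQlv
      (fun h => (hQ x h).2 (by simp)) hlast hyx

open Classical in
theorem sum_card_filter_adj_comm (G : SimpleGraph V) (A B : Finset V) :
    ∑ a ∈ A, (B.filter (G.Adj a)).card = ∑ b ∈ B, (A.filter (G.Adj b)).card := by
  have h := Finset.sum_card_bipartiteAbove_eq_sum_card_bipartiteBelow (s := A) (t := B) G.Adj
  simpa only [Finset.bipartiteAbove, Finset.bipartiteBelow, G.adj_comm] using h

open Classical in
/-- A bipartite graph with many edges contains a nonempty subgraph of large minimum degrees. -/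
theorem exists_subsets_min_degree (G : SimpleGraph V) {α β : ℝ} (hα : 0 ≤ α) (hβ : 0 ≤ β)
    (A B : Finset V)
    (h : α * A.card + β * B.card < ((∑ a ∈ A, (B.filter (G.Adj a)).card : ℕ) : ℝ)) :
    ∃ A' ⊆ A, ∃ B' ⊆ B, A'.Nonempty ∧ B'.Nonempty ∧
      (∀ a ∈ A', α < (B'.filter (G.Adj a)).card) ∧ ∀ b ∈ B', β < (A'.filter (G.Adj b)).card := by
  induction hn : A.card + B.card using Nat.strong_induction_on generalizing A B with
  | _ n ih =>
    by_cases hA : ∃ a ∈ A, ((B.filter (G.Adj a)).card : ℝ) ≤ α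
    · obtain ⟨a, ha, had⟩ := hA
      have hcard := Finset.card_erase_add_one ha
      have hsum := Finset.sum_erase_add A (fun a => (B.filter (G.Adj a)).card) ha
      obtain ⟨A', hA', B', hB', hrest⟩ := ih _ (by omega) (A.erase a) B (by
        rw [← hsum, ← hcard] at h
        push_cast at h ⊢
        linarith) rfl
      exact ⟨A', hA'.trans (Finset.erase_subset _ _), B', hB', hrest⟩
    by_cases hB : ∃ b ∈ B, ((A.filter (G.Adj b)).card : ℝ) ≤ β
    · obtain ⟨b, hb, hbd⟩ := hB
      have hcard := Finset.card_erase_add_one hb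
      have hsum := Finset.sum_erase_add B (fun b => (A.filter (G.Adj b)).card) hb
      obtain ⟨A', hA', B', hB', hrest⟩ := ih _ (by omega) A (B.erase b) (by
        rw [sum_card_filter_adj_comm] at h ⊢
        rw [← hsum, ← hcard] at h
        push_cast at h ⊢
        linarith) rfl
      exact ⟨A', hA', B', hB'.trans (Finset.erase_subset _ _), hrest⟩
    push Not at hA hB
    have hpos : 0 < ∑ a ∈ A, (B.filter (G.Adj a)).card := by
      have h0 : 0 ≤ α * A.card + β * B.card := by positivity
      exact_mod_cast h0.trans_lt h
    obtain ⟨a, ha, had⟩ := Finset.exists_ne_zero_of_sum_ne_zero hpos.ne'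
    obtain ⟨b, hb⟩ := Finset.card_pos.1 (Nat.pos_of_ne_zero had)
    exact ⟨A, subset_rfl, B, subset_rfl, ⟨a, ha⟩, ⟨b, (Finset.mem_filter.1 hb).1⟩, hA, hB⟩

open Classical in
/-- Consecutive levels of a rooted tree span few edges in a graph without `2k`-cycles. -/
theorem sum_card_filter_adj_levels_le {k i : ℕ} {lv : V → ℕ} {par : V → V}
    (hfree : ¬ cycleGraph (2 * k) ⊑ G)
    (hpar : ∀ v, 0 < lv v → lv v ≤ i → G.Adj v (par v) ∧ lv (par v) + 1 = lv v)
    (hroot : ∀ u v, lv u = 0 → lv v = 0 → u = v) (hik : i + 1 ≤ k) {X Y : Finset V}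
    (hX : ∀ x ∈ X, lv x = i) (hY : ∀ y ∈ Y, lv y = i + 1) :
    ((∑ x ∈ X, (Y.filter (G.Adj x)).card : ℕ) : ℝ) ≤ 2 * k * (X.card + Y.card) := by
  by_contra! h
  obtain ⟨X', hX', Y', hY', -, hYne, hdX, hdY⟩ := exists_subsets_min_degree G
    (α := 2 * k) (β := 2 * k) (by positivity) (by positivity) X Y (by linarith)
  exact hfree (cycleGraph_isContained_of_levels_s2 hpar hroot hik (fun x hx => hX x (hX' hx))
    (fun y hy => hY y (hY' hy)) hYne (fun x hx => by exact_mod_cast hdX x hx)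
    (fun y hy => by exact_mod_cast hdY y hy))

/-- Breadth-first search levels, and parents, up to depth `k`. -/
theorem exists_bfs_levels (G : SimpleGraph V) (r : V) (k : ℕ) :
    ∃ (lv : V → ℕ) (par : V → V), (∀ v, lv v = 0 ↔ v = r) ∧
      (∀ v, 0 < lv v → lv v ≤ k → G.Adj v (par v) ∧ lv (par v) + 1 = lv v) ∧
      ∀ u v, G.Adj u v → lv u < k → lv v ≤ lv u + 1 := by
  classical
  let lv : V → ℕ := fun v => if G.Reachable r v then G.dist r v else k + 1
  have hlv : ∀ v, G.Reachable r v → lv v = G.dist r v := fun v hv => if_pos hv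
  have hreach : ∀ v, lv v ≤ k → G.Reachable r v := by
    intro v hv
    by_contra h
    have : lv v = k + 1 := if_neg h
    omega
  have hstep : ∀ u v, G.Adj u v → G.Reachable r u → G.Reachable r v ∧ lv v ≤ lv u + 1 := by
    intro u v huv hu
    have hv := hu.trans huv.reachable
    refine ⟨hv, ?_⟩
    rw [hlv u hu, hlv v hv]
    obtain ⟨w, hw⟩ := hu.exists_walk_length_eq_dist
    rw [← hw, ← Walk.length_concat w huv]
    exact dist_le _
  have hpar : ∀ v, ∃ p, 0 < lv v → lv v ≤ k → G.Adj v p ∧ lv p + 1 = lv v := by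
    intro v
    by_cases hv : 0 < lv v ∧ lv v ≤ k
    · have hrv := hreach v hv.2
      have hpos := hv.1
      obtain ⟨w, hw⟩ := hrv.symm.exists_walk_length_eq_dist
      rw [dist_comm, ← hlv v hrv] at hw
      cases w with
      | nil => rw [Walk.length_nil] at hw; omega
      | @cons _ p _ h q =>
        refine ⟨p, fun _ _ => ⟨h, ?_⟩⟩
        have h1 : lv p ≤ q.length := by
          rw [hlv p q.reachable.symm, dist_comm]
          exact dist_le q
        have h2 := (hstep p v h.symm q.reachable.symm).2
        rw [Walk.length_cons] at hw
        omega
    · exact ⟨v, fun h1 h2 => absurd ⟨h1, h2⟩ hv⟩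
  choose par hpar using hpar
  refine ⟨lv, par, fun v => ⟨fun h => ?_, ?_⟩, hpar, fun u v huv hu =>
    (hstep u v huv (hreach u hu.le)).2⟩
  · have hrv := hreach v (by omega)
    rw [hlv v hrv] at h
    exact (hrv.dist_eq_zero_iff.1 h).symm
  · rintro rfl
    rw [hlv v .rfl, dist_self]

open Classical in
/-- In a bipartite graph of large minimum degrees without `2k`-cycles, the breadth-first search
levels grow geometrically. -/
theorem exists_large_level [Fintype V] {k : ℕ} (hk : 0 < k) (hfree : ¬ cycleGraph (2 * k) ⊑ G)
    {A B : Finset V} (hAB : Disjoint A B)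
    (hG : ∀ u v, G.Adj u v → u ∈ A ∧ v ∈ B ∨ u ∈ B ∧ v ∈ A) {α β : ℝ}
    (hα : 12 * k ≤ α) (hβ : 12 * k ≤ β) (hA : ∀ a ∈ A, α ≤ (B.filter (G.Adj a)).card)
    (hB : ∀ b ∈ B, β ≤ (A.filter (G.Adj b)).card) (hne : A.Nonempty) :
    ∃ L ⊆ if Even k then A else B,
      ∏ j ∈ Finset.range k, ((if Even j then α else β) / (4 * k)) ≤ (L.card : ℝ) := by
  obtain ⟨r, hr⟩ := hne
  obtain ⟨lv, par, hroot, hpar, hstep⟩ := exists_bfs_levels G r k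
  have hk' : (0 : ℝ) < k := by exact_mod_cast hk
  let S : ℕ → Finset V := fun i => if Even i then A else B
  let δ : ℕ → ℝ := fun i => if Even i then α else β
  let L : ℕ → Finset V := fun i => Finset.univ.filter (fun v => lv v = i)
  have hL : ∀ i v, v ∈ L i ↔ lv v = i := fun i v => by simp [L]
  have hδ : ∀ i, 12 * k ≤ δ i := by
    intro i
    by_cases h : Even i <;> simp [δ, h, hα, hβ]
  have hdisj : ∀ i, Disjoint (S i) (S (i + 1)) := by
    intro i
    by_cases h : Even i <;> simp [S, h, Nat.even_add_one, hAB, hAB.symm]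
  have hS : ∀ i u v, u ∈ S i → G.Adj u v → v ∈ S (i + 1) := by
    intro i u v hu huv
    have := hG u v huv
    have hd := Finset.disjoint_left.1 hAB
    by_cases h : Even i <;> simp only [S, h, Nat.even_add_one, if_true, if_false, not_true_eq_false,
      not_false_eq_true] at hu ⊢ <;> grind
  have hdeg : ∀ i, ∀ u ∈ S i, δ i ≤ ((S (i + 1)).filter (G.Adj u)).card := by
    intro i u hu
    by_cases h : Even i <;> simp only [S, δ, h, Nat.even_add_one, if_true, if_false,
      not_true_eq_false, not_false_eq_true] at hu ⊢
    · exact hA u hu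
    · exact hB u hu
  have hLS : ∀ i ≤ k, L i ⊆ S i := by
    intro i
    induction i with
    | zero =>
      intro _ v hv
      rw [hL, hroot] at hv
      simpa [S, hv] using hr
    | succ i ih =>
      intro hi v hv
      rw [hL] at hv
      obtain ⟨h1, h2⟩ := hpar v (by omega) (by omega)
      exact hS i _ _ (ih (by omega) ((hL _ _).2 (by omega))) h1.symm
  let up : ℕ → V → ℕ := fun i u => ((L (i + 1)).filter (G.Adj u)).card
  let down : ℕ → V → ℕ := fun i u => (Finset.univ.filter (fun v => G.Adj u v ∧ lv v + 1 = i)).card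
  have hsplit : ∀ i < k, ∀ u ∈ L i, δ i ≤ up i u + down i u := by
    intro i hi u hu
    refine (hdeg i u (hLS i hi.le hu)).trans ?_
    norm_cast
    refine (Finset.card_le_card ?_).trans (Finset.card_union_le _ _)
    intro v hv
    rw [Finset.mem_filter] at hv
    rw [hL] at hu
    have h1 := hstep u v hv.2 (by omega)
    have h2 : lv u ≤ lv v + 1 := by
      by_cases h : lv v < k
      · exact hstep v u hv.2.symm h
      · omega
    have h3 : lv v ≠ i := fun h => Finset.disjoint_left.1 (hdisj i)
      (hLS i hi.le ((hL _ _).2 h)) hv.1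
    rw [Finset.mem_union]
    by_cases h : lv v = i + 1
    · exact Or.inl (Finset.mem_filter.2 ⟨(hL _ _).2 h, hv.2⟩)
    · exact Or.inr (Finset.mem_filter.2 ⟨Finset.mem_univ _, hv.2, by omega⟩)
  have hupsum : ∀ i < k, ((∑ u ∈ L i, up i u : ℕ) : ℝ) ≤ 2 * k * ((L i).card + (L (i + 1)).card) :=
    fun i hi => sum_card_filter_adj_levels_le hfree (fun v h h' => hpar v h (by omega))
      (fun u v hu hv => ((hroot u).1 hu).trans ((hroot v).1 hv).symm) hi (fun x => (hL i x).1)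
      (fun y => (hL (i + 1) y).1)
  have hdown : ∀ i, ∑ u ∈ L (i + 1), down (i + 1) u = ∑ u ∈ L i, up i u := by
    intro i
    simp only [up]
    rw [sum_card_filter_adj_comm]
    refine Finset.sum_congr rfl fun u _ => congrArg Finset.card ?_
    ext v
    simp [hL, and_comm]
  have hmain : ∀ i ≤ k, ∏ j ∈ Finset.range i, (δ j / (4 * k)) ≤ ((L i).card : ℝ) ∧
      ((∑ u ∈ L i, down i u : ℕ) : ℝ) ≤ 4 * k * (L i).card := by
    intro i
    induction i with
    | zero =>
      intro _
      constructor
      · have : 0 < (L 0).card := Finset.card_pos.2 ⟨r, (hL _ _).2 ((hroot r).2 rfl)⟩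
        simpa using this
      · have : ∑ u ∈ L 0, down 0 u = 0 := by simp [down]
        rw [this, Nat.cast_zero]
        positivity
    | succ i ih =>
      intro hi
      obtain ⟨hprod, hd⟩ := ih (by omega)
      have hu := hupsum i hi
      have hsum : δ i * (L i).card ≤ ((∑ u ∈ L i, up i u : ℕ) : ℝ) +
          ((∑ u ∈ L i, down i u : ℕ) : ℝ) := by
        push_cast
        rw [← Finset.sum_add_distrib, mul_comm, ← nsmul_eq_mul]
        exact Finset.card_nsmul_le_sum _ _ _ (hsplit i hi)
      have hLi : (0 : ℝ) ≤ (L i).card := by positivity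
      have h12 := mul_le_mul_of_nonneg_right (hδ i) hLi
      have hgrow : δ i / (4 * k) * (L i).card ≤ (L (i + 1)).card := by
        rw [div_mul_eq_mul_div, div_le_iff₀ (by positivity)]
        linarith
      have hmono : ((L i).card : ℝ) ≤ (L (i + 1)).card := by
        refine le_trans ?_ hgrow
        refine le_mul_of_one_le_left hLi ?_
        rw [one_le_div (by positivity)]
        linarith [hδ i]
      constructor
      · rw [Finset.prod_range_succ, mul_comm]
        refine le_trans ?_ hgrow
        refine mul_le_mul_of_nonneg_left hprod (div_nonneg ?_ (by positivity))
        linarith [hδ i]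
      · rw [hdown]
        refine hu.trans ?_
        have := mul_le_mul_of_nonneg_left hmono hk'.le
        linarith
  exact ⟨L k, hLS k le_rfl, (hmain k le_rfl).1⟩

open Classical in
/-- The product of the sizes of the two sides is large in a bipartite graph of large minimum degrees
without `2k`-cycles. -/
theorem pow_le_card_mul_card [Fintype V] {k : ℕ} (hk : 0 < k) (hfree : ¬ cycleGraph (2 * k) ⊑ G)
    {A B : Finset V} (hAB : Disjoint A B) {α β : ℝ} (hα : 12 * k ≤ α) (hβ : 12 * k ≤ β)
    (hA : ∀ a ∈ A, α ≤ (B.filter (G.Adj a)).card) (hB : ∀ b ∈ B, β ≤ (A.filter (G.Adj b)).card)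
    (hAne : A.Nonempty) (hBne : B.Nonempty) :
    (α * β / (4 * k) ^ 2) ^ k ≤ (A.card : ℝ) * B.card := by
  obtain ⟨H, hH⟩ : ∃ H : SimpleGraph V, ∀ u v,
      H.Adj u v ↔ G.Adj u v ∧ (u ∈ A ∧ v ∈ B ∨ u ∈ B ∧ v ∈ A) :=
    ⟨{ Adj := fun u v => G.Adj u v ∧ (u ∈ A ∧ v ∈ B ∨ u ∈ B ∧ v ∈ A)
       symm := ⟨fun u v h => ⟨h.1.symm, by tauto⟩⟩
       loopless := ⟨fun u h => h.1.ne rfl⟩ }, fun u v => Iff.rfl⟩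
  have hHG : H ≤ G := fun u v h => ((hH u v).1 h).1
  have hHfree : ¬ cycleGraph (2 * k) ⊑ H := fun h => hfree (h.mono_right hHG)
  have hHA : ∀ a ∈ A, α ≤ (B.filter (H.Adj a)).card := by
    intro a ha
    convert hA a ha using 3
    refine Finset.filter_congr fun b hb => ?_
    exact ⟨fun h => hHG h, fun h => (hH a b).2 ⟨h, Or.inl ⟨ha, hb⟩⟩⟩
  have hHB : ∀ b ∈ B, β ≤ (A.filter (H.Adj b)).card := by
    intro b hb
    convert hB b hb using 3
    refine Finset.filter_congr fun a ha => ?_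
    exact ⟨fun h => hHG h, fun h => (hH b a).2 ⟨h, Or.inr ⟨hb, ha⟩⟩⟩
  obtain ⟨L, hL, hLcard⟩ := exists_large_level hk hHfree hAB (fun u v h => ((hH u v).1 h).2)
    hα hβ hHA hHB hAne
  obtain ⟨M, hM, hMcard⟩ := exists_large_level hk hHfree hAB.symm 
    (fun u v h => ((hH u v).1 h).2.symm) hβ hα hHB hHA hBne
  have hk' : (0 : ℝ) < k := by exact_mod_cast hk
  have hα0 : 0 ≤ α := by linarith
  have hβ0 : 0 ≤ β := by linarith
  have hprod : (α * β / (4 * k) ^ 2) ^ k =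
      (∏ j ∈ Finset.range k, ((if Even j then α else β) / (4 * k))) *
        ∏ j ∈ Finset.range k, ((if Even j then β else α) / (4 * (k : ℝ))) := by
    rw [← Finset.prod_mul_distrib, ← Finset.card_range k, ← Finset.prod_const, Finset.card_range]
    refine Finset.prod_congr rfl fun j _ => ?_
    split_ifs <;> field_simp
  have hLM : (L.card : ℝ) * M.card ≤ A.card * B.card := by
    have h1 := Finset.card_le_card hL
    have h2 := Finset.card_le_card hM
    norm_cast
    split_ifs at h1 h2
    · exact Nat.mul_le_mul h1 h2
    · rw [mul_comm]
      exact Nat.mul_le_mul h2 h1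
  rw [hprod]
  refine le_trans (mul_le_mul hLcard hMcard (Finset.prod_nonneg fun j _ => ?_) (by positivity)) hLM
  split_ifs <;> positivity

open Classical in
theorem sum_card_filter_adj_le_of_disjoint [Fintype V] {k : ℕ} (hk : 0 < k)
    (hfree : ¬ cycleGraph (2 * k) ⊑ G) {A B : Finset V} (hAB : Disjoint A B) :
    ((∑ a ∈ A, (B.filter (G.Adj a)).card : ℕ) : ℝ) ≤
      36 * k * ((A.card : ℝ) + B.card +
        ((A.card : ℝ) * B.card) ^ (((k : ℝ) + 1) / (2 * (k : ℝ)))) := by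
  have hk' : (0 : ℝ) < k := by exact_mod_cast hk
  obtain ⟨e, he⟩ : ∃ e : ℝ, e = ((∑ a ∈ A, (B.filter (G.Adj a)).card : ℕ) : ℝ) := ⟨_, rfl⟩
  rw [← he]
  have hpow : 0 ≤ ((A.card : ℝ) * B.card) ^ (((k : ℝ) + 1) / (2 * (k : ℝ))) := by positivity
  have hmul := mul_nonneg (by positivity : (0 : ℝ) ≤ k) hpow
  by_cases hsmall : e ≤ 36 * k * ((A.card : ℝ) + B.card)
  · linarith
  push Not at hsmall
  have he0 : 0 < e := lt_of_le_of_lt (by positivity) hsmall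
  have hApos : 0 < A.card := by
    by_contra h
    have : A = ∅ := by simpa using h
    simp [he, this] at he0
  have hBpos : 0 < B.card := by
    by_contra h
    have : B = ∅ := by simpa using h
    simp [he, this] at he0
  obtain ⟨m, hm⟩ : ∃ m : ℝ, m = A.card := ⟨_, rfl⟩
  obtain ⟨n, hn⟩ : ∃ n : ℝ, n = B.card := ⟨_, rfl⟩
  have hm0 : (0 : ℝ) < A.card := by exact_mod_cast hApos
  have hn0 : (0 : ℝ) < B.card := by exact_mod_cast hBpos
  rw [← hm] at hm0 hsmall hpow hmul ⊢
  rw [← hn] at hn0 hsmall hpow hmul ⊢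
  obtain ⟨A', hA', B', hB', hAne, hBne, hdA, hdB⟩ := exists_subsets_min_degree G
    (α := e / (3 * m)) (β := e / (3 * n)) (by positivity) (by positivity) A B (by
      rw [← he, ← hm, ← hn]
      have h1 : e / (3 * m) * m = e / 3 := by field_simp
      have h2 : e / (3 * n) * n = e / 3 := by field_simp
      rw [h1, h2]
      linarith)
  have hkm := mul_pos hk' hm0
  have hkn := mul_pos hk' hn0
  have hprod := pow_le_card_mul_card hk hfree
    (Finset.disjoint_of_subset_left hA' (Finset.disjoint_of_subset_right hB' hAB))
    (by rw [le_div_iff₀ (by positivity)]; linarith) (by rw [le_div_iff₀ (by positivity)]; linarith)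
    (fun a ha => (hdA a ha).le) (fun b hb => (hdB b hb).le) hAne hBne
  have hcard : (A'.card : ℝ) * B'.card ≤ m * n := by
    rw [hm, hn]
    exact_mod_cast Nat.mul_le_mul (Finset.card_le_card hA') (Finset.card_le_card hB')
  have hrw : e / (3 * m) * (e / (3 * n)) / (4 * k) ^ 2 = (e / (12 * k)) ^ 2 / (m * n) := by
    field_simp
    norm_num
  rw [hrw, div_pow, ← pow_mul] at hprod
  have hfinal : (e / (12 * k)) ^ (2 * k) ≤ (m * n) ^ (k + 1) := by
    have := hprod.trans hcard
    rw [div_le_iff₀ (by positivity)] at this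
    rw [pow_succ]
    exact this.trans_eq (mul_comm _ _)
  have hroot : e / (12 * k) ≤ (m * n) ^ (((k : ℝ) + 1) / (2 * (k : ℝ))) := by
    refine le_of_pow_le_pow_left₀ (n := 2 * k) (by omega) hpow (hfinal.trans_eq ?_)
    rw [← Real.rpow_natCast _ (2 * k), ← Real.rpow_mul (by positivity), ← Real.rpow_natCast]
    congr 1
    push_cast
    field_simp
  rw [div_le_iff₀ (by positivity)] at hroot
  have hkmn := add_pos hkm hkn
  linarith

open Classical in
/-- Some disjoint subsets of two given vertex sets span a quarter of the edges between them. -/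
theorem exists_disjoint_subsets_sum_card_filter_adj [Fintype V] (G : SimpleGraph V)
    (A B : Finset V) :
    ∃ A' ⊆ A, ∃ B' ⊆ B, Disjoint A' B' ∧
      ∑ a ∈ A, (B.filter (G.Adj a)).card ≤ 4 * ∑ a ∈ A', (B'.filter (G.Adj a)).card := by
  let N : ℕ := Fintype.card (Finset V)
  let E : Finset (V × V) := (A ×ˢ B).filter (fun p => G.Adj p.1 p.2)
  have hsum : ∀ A B : Finset V, ∑ a ∈ A, (B.filter (G.Adj a)).card =
      ((A ×ˢ B).filter (fun p => G.Adj p.1 p.2)).card := by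
    intro A B
    simp only [Finset.card_filter, Finset.sum_product]
  have hcut : ∀ p ∈ E,
      4 * ((Finset.univ : Finset (Finset V)).filter (fun S => p.1 ∈ S ∧ p.2 ∉ S)).card = N := by
    intro p hp
    have hne : p.1 ≠ p.2 := (Finset.mem_filter.1 hp).2.ne
    have hIcc : (Finset.univ : Finset (Finset V)).filter (fun S => p.1 ∈ S ∧ p.2 ∉ S) =
        Finset.Icc {p.1} {p.2}ᶜ := by
      ext S
      simp [Finset.mem_Icc, Finset.subset_compl_comm (s := S)]
    have h2 : 1 < Fintype.card V := Fintype.one_lt_card_iff.2 ⟨_, _, hne⟩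
    rw [hIcc, Finset.card_Icc_finset (by simpa using hne.symm), Finset.card_compl,
      Finset.card_singleton, Finset.card_singleton]
    simp only [N, Fintype.card_finset]
    rw [show (4 : ℕ) = 2 ^ 2 by norm_num, ← pow_add]
    congr 1
    omega
  have htotal : ∑ S : Finset V, 4 * (E.filter (fun p => p.1 ∈ S ∧ p.2 ∉ S)).card =
      ∑ _S : Finset V, E.card := by
    have h := Finset.sum_card_bipartiteAbove_eq_sum_card_bipartiteBelow
      (s := (Finset.univ : Finset (Finset V))) (t := E) (fun S p => p.1 ∈ S ∧ p.2 ∉ S)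
    simp only [Finset.bipartiteAbove, Finset.bipartiteBelow] at h
    rw [← Finset.mul_sum, h, Finset.mul_sum, Finset.sum_congr rfl hcut, Finset.sum_const,
      Finset.sum_const, smul_eq_mul, smul_eq_mul, mul_comm, Finset.card_univ]
  obtain ⟨S, -, hS⟩ := Finset.exists_le_of_sum_le Finset.univ_nonempty htotal.ge
  refine ⟨A.filter (· ∈ S), Finset.filter_subset _ _, B.filter (· ∉ S), Finset.filter_subset _ _,
    ?_, ?_⟩
  · rw [Finset.disjoint_left]
    intro v hv hv'
    exact (Finset.mem_filter.1 hv').2 (Finset.mem_filter.1 hv).2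
  · rw [hsum, hsum]
    refine hS.trans (Nat.mul_le_mul_left 4 (Finset.card_le_card ?_))
    intro p hp
    simp only [E, Finset.mem_filter, Finset.mem_product] at hp ⊢
    tauto

open Classical in
theorem eCount_le_sum_card_filter_adj [Fintype V] (G : SimpleGraph V) (A B : Set V) :
    eCount G A B ≤ ∑ a ∈ A.toFinset, (B.toFinset.filter (G.Adj a)).card := by
  have hsub : {e ∈ G.edgeSet | ∃ u ∈ A, ∃ v ∈ B, e = s(u, v)} ⊆
      ((((A.toFinset ×ˢ B.toFinset).filter (fun p => G.Adj p.1 p.2)).image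
        (fun p => s(p.1, p.2)) : Finset (Sym2 V)) : Set (Sym2 V)) := by
    rintro _ ⟨he, u, hu, v, hv, rfl⟩
    simp only [Finset.coe_image, Set.mem_image, Finset.mem_coe, Finset.mem_filter,
      Finset.mem_product, Set.mem_toFinset]
    exact ⟨(u, v), ⟨⟨hu, hv⟩, he⟩, rfl⟩
  refine (Set.ncard_le_ncard hsub (Finset.finite_toSet _)).trans ?_
  rw [Set.ncard_coe_finset]
  refine Finset.card_image_le.trans_eq ?_
  simp only [Finset.card_filter, Finset.sum_product]

end EvenCycles

/-- Extremal bound for `C_{2k}`-free graphs between two (not necessarily disjoint)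
vertex subsets: `e(A,B) ≤ C_k·(|A| + |B| + (|A|·|B|)^((k+1)/(2k)))`. -/
theorem eAB_bound_of_C2k_free (k : ℕ) (hk : 2 ≤ k) :
    ∃ C : ℝ, 0 < C ∧
      ∀ (V : Type) [Fintype V] (G : SimpleGraph V),
        (¬ ∃ H : G.Subgraph, Nonempty (H.coe ≃g cycleGraph (2 * k))) →
        ∀ A B : Set V,
          (eCount G A B : ℝ) ≤
            C * ((A.ncard : ℝ) + (B.ncard : ℝ) +
              ((A.ncard : ℝ) * (B.ncard : ℝ)) ^ (((k : ℝ) + 1) / (2 * (k : ℝ)))) := by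
  classical
  have hk0 : 0 < k := by omega
  refine ⟨144 * k, by positivity, ?_⟩
  intro V _ G hG A B
  have hfree : ¬ cycleGraph (2 * k) ⊑ G := by
    intro h
    obtain ⟨H, ⟨f⟩⟩ := h.exists_iso_subgraph
    exact hG ⟨H, ⟨f.symm⟩⟩
  obtain ⟨A', hA', B', hB', hdisj, hcut⟩ :=
    exists_disjoint_subsets_sum_card_filter_adj G A.toFinset B.toFinset
  have hbound := sum_card_filter_adj_le_of_disjoint hk0 hfree hdisj
  have hcount : (eCount G A B : ℝ) ≤ 4 * ((∑ a ∈ A', (B'.filter (G.Adj a)).card : ℕ) : ℝ) := by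
    exact_mod_cast (eCount_le_sum_card_filter_adj G A B).trans hcut
  have hAcard : (A'.card : ℝ) ≤ A.ncard := by
    rw [Set.ncard_eq_toFinset_card']
    exact_mod_cast Finset.card_le_card hA'
  have hBcard : (B'.card : ℝ) ≤ B.ncard := by
    rw [Set.ncard_eq_toFinset_card']
    exact_mod_cast Finset.card_le_card hB'
  calc (eCount G A B : ℝ) ≤ _ := hcount
    _ ≤ 4 * _ := mul_le_mul_of_nonneg_left hbound (by norm_num)
    _ = 144 * k * ((A'.card : ℝ) + B'.card +
        ((A'.card : ℝ) * B'.card) ^ (((k : ℝ) + 1) / (2 * (k : ℝ)))) := by ring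
    _ ≤ _ := by gcongr
end

section
/- For every integer k ≥ 2 there is a constant C_k > 0 (depending only on k) such that the following holds. Let G be a finite simple graph with m edges that contains no copy of C_{2k} and whose maximum degree satisfies Δ(G) ≤ m^(2/(k+1)). Fix a vertex subset A ⊆ V(G) and a positive integer d with d ≤ Δ(G), and let B be the set of vertices v ∈ V(G) with d/2 ≤ |N(v) ∩ A| ≤ d. Then d·√|B| ≤ C_k·m^(1/(k+1))·√|A|. -/
open SimpleGraph

open Finset in
/-- If a bipartite relation has more than `p * #X + q * #Y` incidences, then it has a nonempty
sub-pair in which the degrees are at least `p` on the left and at least `q` on the right. -/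
lemma exists_subpair_le_degree {α β : Type*} [DecidableEq α] [DecidableEq β] (r : α → β → Prop)
    [∀ a b, Decidable (r a b)] (p q : ℝ) (X : Finset α) (Y : Finset β)
    (h : p * #X + q * #Y < ∑ x ∈ X, (#{y ∈ Y | r x y} : ℝ)) (hq : 0 ≤ q) :
    ∃ X' ⊆ X, ∃ Y' ⊆ Y, X'.Nonempty ∧ (∀ x ∈ X', p ≤ #{y ∈ Y' | r x y}) ∧
      ∀ y ∈ Y', q ≤ #{x ∈ X' | r x y} := by
  have hswap : ∀ (X : Finset α) (Y : Finset β),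
      ∑ x ∈ X, (#{y ∈ Y | r x y} : ℝ) = ∑ y ∈ Y, (#{x ∈ X | r x y} : ℝ) := fun X Y => by
    exact_mod_cast sum_card_bipartiteAbove_eq_sum_card_bipartiteBelow (s := X) (t := Y) r
  induction hn : #X + #Y generalizing X Y with
  | zero =>
    have hX : X = ∅ := by rw [← card_eq_zero]; omega
    have hY : Y = ∅ := by rw [← card_eq_zero]; omega
    simp [hX, hY] at h
  | succ n ih =>
    by_cases h1 : ∃ x ∈ X, (#{y ∈ Y | r x y} : ℝ) < p
    · obtain ⟨x, hx, hxp⟩ := h1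
      have hc := card_erase_add_one hx
      have hc' : (#(X.erase x) : ℝ) + 1 = #X := by exact_mod_cast hc
      have hs := add_sum_erase X (fun x => (#{y ∈ Y | r x y} : ℝ)) hx
      obtain ⟨X', hX', Y', hY', H⟩ := ih (X.erase x) Y (by rw [← hc'] at h; linarith) (by omega)
      exact ⟨X', hX'.trans (erase_subset _ _), Y', hY', H⟩
    by_cases h2 : ∃ y ∈ Y, (#{x ∈ X | r x y} : ℝ) < q
    · obtain ⟨y, hy, hyq⟩ := h2
      have hc := card_erase_add_one hy
      have hc' : (#(Y.erase y) : ℝ) + 1 = #Y := by exact_mod_cast hc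
      have hs := add_sum_erase Y (fun y => (#{x ∈ X | r x y} : ℝ)) hy
      rw [hswap] at h
      obtain ⟨X', hX', Y', hY', H⟩ := ih X (Y.erase y)
        (by rw [hswap]; rw [← hc'] at h; linarith) (by omega)
      exact ⟨X', hX', Y', hY'.trans (erase_subset _ _), H⟩
    push Not at h1 h2
    refine ⟨X, subset_rfl, Y, subset_rfl, ?_, h1, h2⟩
    rw [nonempty_iff_ne_empty]
    rintro rfl
    simp only [card_empty, CharP.cast_eq_zero, mul_zero, zero_add, sum_empty] at h
    have : 0 ≤ q * #Y := by positivity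
    linarith

/-- A cyclic sequence of `n` distinct vertices, consecutive ones adjacent, gives a copy of the
`n`-cycle. -/
lemma cycleGraph_isContained_of_seq {V : Type*} {G : SimpleGraph V} {n : ℕ} (f : ℕ → V)
    (hinj : Set.InjOn f (Set.Iio n)) (hadj : ∀ t, t + 1 < n → G.Adj (f t) (f (t + 1)))
    (hlast : G.Adj (f (n - 1)) (f 0)) : (cycleGraph n).IsContained G := by
  have key : ∀ u v : Fin n, (u - v).val = 1 → G.Adj (f v) (f u) := by
    intro u v h
    rw [Fin.sub_def] at h
    simp only at h
    have hu := u.isLt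
    have hv := v.isLt
    rcases le_or_gt v.val u.val with hle | hlt
    · have h1 : n - v.val + u.val = (u.val - v.val) + n := by omega
      rw [h1, Nat.add_mod_right, Nat.mod_eq_of_lt (by omega)] at h
      have h2 : u.val = v.val + 1 := by omega
      rw [h2]
      exact hadj _ (by omega)
    · rw [Nat.mod_eq_of_lt (by omega)] at h
      have h1 : u.val = 0 := by omega
      have h2 : v.val = n - 1 := by omega
      rw [h1, h2]
      exact hlast
  refine ⟨⟨⟨fun t => f t, ?_⟩, ?_⟩⟩
  · intro u v h
    rw [cycleGraph_adj'] at h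
    rcases h with h | h
    · exact (key u v h).symm
    · exact key v u h
  · intro u v h
    exact Fin.ext (hinj u.isLt v.isLt h)

open Finset in
/-- In a bipartite graph with parts `X`, `Y` and degrees at least `D`, every vertex `y ∈ Y` starts
a path of any length `t` with `t + #F ≤ D` that avoids a given set `F ⊆ X`. -/
lemma exists_path_avoiding {V : Type*} [DecidableEq V] {G : SimpleGraph V} [DecidableRel G.Adj]
    {X Y F : Finset V} {D : ℕ} (hXY : Disjoint X Y) (hFX : F ⊆ X)
    (hdX : ∀ x ∈ X, D ≤ #{y ∈ Y | G.Adj x y}) (hdY : ∀ y ∈ Y, D ≤ #{x ∈ X | G.Adj y x})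
    {y : V} (hy : y ∈ Y) (t : ℕ) (ht : t + #F ≤ D) :
    ∃ g : ℕ → V, g 0 = y ∧ (∀ s ≤ t, Odd s → g s ∈ X) ∧ (∀ s ≤ t, Even s → g s ∈ Y) ∧
      (∀ s < t, G.Adj (g s) (g (s + 1))) ∧ Set.InjOn g (Set.Iic t) ∧ ∀ s ≤ t, g s ∉ F := by
  induction t with
  | zero =>
    refine ⟨fun _ => y, rfl, ?_, ?_, ?_, ?_, ?_⟩
    · intro s hs ho
      obtain rfl : s = 0 := by omega
      simp at ho
    · intro s _ _
      exact hy
    · intro s hs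
      omega
    · intro a ha b hb _
      simp only [Set.mem_Iic] at ha hb
      omega
    · intro s _ hF
      exact disjoint_left.1 hXY (hFX hF) hy
  | succ t ih =>
    obtain ⟨g, h0, hX, hY, hadj, hinj, hF⟩ := ih (by omega)
    set P := (range t).image g with hP
    have hcard : #(P ∪ F) < D := by
      have h1 := card_union_le P F
      have h2 : #P ≤ t := by simpa using card_image_le (s := range t) (f := g)
      omega
    obtain ⟨w, hw, hwadj, hwnot⟩ : ∃ w, (if Even t then w ∈ X else w ∈ Y) ∧ G.Adj (g t) w ∧
        w ∉ P ∪ F := by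
      by_cases he : Even t
      · obtain ⟨w, hw, hn⟩ := exists_mem_notMem_of_card_lt_card
          (hcard.trans_le (hdY _ (hY t le_rfl he)))
        rw [mem_filter] at hw
        exact ⟨w, by simpa [he] using hw.1, hw.2, hn⟩
      · obtain ⟨w, hw, hn⟩ := exists_mem_notMem_of_card_lt_card
          (hcard.trans_le (hdX _ (hX t le_rfl (Nat.not_even_iff_odd.1 he))))
        rw [mem_filter] at hw
        exact ⟨w, by simpa [he] using hw.1, hw.2, hn⟩
    have hwg : ∀ s ≤ t, g s ≠ w := by
      intro s hs h
      rcases hs.lt_or_eq with hs | rfl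
      · exact hwnot (mem_union_left _ (mem_image.2 ⟨s, mem_range.2 hs, h⟩))
      · exact hwadj.ne h
    have hnew : ∀ s, s ≤ t + 1 → ¬ s ≤ t → s = t + 1 := fun s h1 h2 => by omega
    refine ⟨fun s => if s ≤ t then g s else w, by simpa using h0, ?_, ?_, ?_, ?_, ?_⟩
    · intro s hs ho
      by_cases h : s ≤ t
      · simpa [h] using hX s h ho
      · obtain rfl := hnew s hs h
        have : Even t := by simpa [Nat.odd_add_one] using ho
        simpa [this] using hw
    · intro s hs ho
      by_cases h : s ≤ t
      · simpa [h] using hY s h ho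
      · obtain rfl := hnew s hs h
        have : ¬ Even t := by simpa [Nat.even_add_one] using ho
        simpa only [h, this, if_false] using hw
    · intro s hs
      by_cases h : s + 1 ≤ t
      · simpa [h, show s ≤ t by omega] using hadj s (by omega)
      · obtain rfl : s = t := by omega
        simpa using hwadj
    · intro a ha b hb hab
      simp only [Set.mem_Iic] at ha hb
      by_cases h1 : a ≤ t <;> by_cases h2 : b ≤ t
      · simp only [h1, h2, if_true] at hab
        exact hinj h1 h2 hab
      · simp only [h1, h2, if_true, if_false] at hab
        exact absurd hab (hwg a h1)
      · simp only [h1, h2, if_true, if_false] at hab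
        exact absurd hab.symm (hwg b h2)
      · omega
    · intro s hs
      by_cases h : s ≤ t
      · simpa [h] using hF s h
      · simpa [h] using fun hwF => hwnot (mem_union_right _ hwF)

/-- In a layered forest with parent map `π`, the level drops by one at each application of `π`. -/
lemma level_iterate_parent {V : Type*} {lev : V → ℕ∞} {π : V → V}
    (hπ : ∀ (i : ℕ) v, lev v = (i + 1 : ℕ) → lev (π v) = i) {i : ℕ} {v : V} (hv : lev v = i)
    (s : ℕ) (hs : s ≤ i) : lev (π^[s] v) = (i - s : ℕ) := by
  induction s with
  | zero => simpa using hv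
  | succ s ih =>
    rw [Function.iterate_succ_apply']
    apply hπ
    rw [ih (by omega)]
    congr 1
    omega

/-- Two vertices `x`, `z` on level `i` of a layered forest whose ancestor paths first meet after
`m + 1` steps, joined by a path of length `l` on levels at least `i`, lie on a cycle of length
`l + 2 * (m + 1)`. -/
lemma cycleGraph_isContained_of_level_path {V : Type*} {G : SimpleGraph V} {lev : V → ℕ∞}
    {π : V → V} (hπ : ∀ (i : ℕ) v, lev v = (i + 1 : ℕ) → lev (π v) = i)
    (hadjπ : ∀ (i : ℕ) v, lev v = (i + 1 : ℕ) → G.Adj v (π v)) {i m l : ℕ} (hm : m < i) {x z : V}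
    (hx : lev x = i) (hz : lev z = i) (hne : π^[m] x ≠ π^[m] z)
    (heq : π^[m + 1] x = π^[m + 1] z) (h : ℕ → V) (h0 : h 0 = x) (hl : h l = z)
    (hlev : ∀ s ≤ l, (i : ℕ∞) ≤ lev (h s)) (hinj : Set.InjOn h (Set.Iic l))
    (hadj : ∀ s < l, G.Adj (h s) (h (s + 1))) :
    (cycleGraph (l + 2 * (m + 1))).IsContained G := by
  have hstep : ∀ v, lev v = i → ∀ s < i, G.Adj (π^[s] v) (π^[s + 1] v) := by
    intro v hv s hs
    rw [Function.iterate_succ_apply']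
    refine hadjπ (i - s - 1) _ ?_
    rw [level_iterate_parent hπ hv s hs.le]
    congr 1
    omega
  have hlevx := level_iterate_parent hπ hx
  have hlevz := level_iterate_parent hπ hz
  have hne' : ∀ s ≤ m, π^[s] x ≠ π^[s] z := by
    intro s hs he
    apply hne
    obtain ⟨c, rfl⟩ := Nat.exists_eq_add_of_le' hs
    rw [Function.iterate_add_apply, he, ← Function.iterate_add_apply]
  set n := l + 2 * (m + 1) with hn
  set f : ℕ → V := fun t => if t ≤ l then h t else if t ≤ l + (m + 1) then π^[t - l] z
    else π^[n - t] x with hf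
  have f1 : ∀ t ≤ l, f t = h t := fun t ht => by simp [hf, ht]
  have f2 : ∀ t, l ≤ t → t ≤ l + (m + 1) → f t = π^[t - l] z := fun t ht ht' => by
    rcases ht.eq_or_lt with rfl | hlt
    · simp [hf, hl]
    · simp [hf, hlt.not_ge, ht']
  have f3 : ∀ t, l + (m + 1) ≤ t → t ≤ n → f t = π^[n - t] x := fun t ht ht' => by
    rcases ht.eq_or_lt with rfl | hlt
    · rw [f2 _ (by omega) le_rfl, show l + (m + 1) - l = m + 1 by omega,
        show n - (l + (m + 1)) = m + 1 by omega, heq]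
    · simp [hf, hlt.not_ge, show ¬ t ≤ l by omega]
  have low : ∀ a b, a ≤ l → l < b → b < n → f a ≠ f b := by
    intro a b ha hb hbn hab
    have h1 := hlev a ha
    rw [← f1 a ha, hab] at h1
    rcases le_or_gt b (l + (m + 1)) with hb' | hb'
    · rw [f2 b hb.le hb', hlevz _ (by omega), Nat.cast_le] at h1
      omega
    · rw [f3 b hb'.le hbn.le, hlevx _ (by omega), Nat.cast_le] at h1
      omega
  have mid : ∀ a b, l < a → a ≤ l + (m + 1) → l + (m + 1) < b → b < n → f a ≠ f b := by
    intro a b ha ha' hb hb' hab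
    rw [f2 a ha.le ha', f3 b hb.le hb'.le] at hab
    have h1 := hlevz (a - l) (by omega)
    rw [hab, hlevx _ (by omega), Nat.cast_inj] at h1
    have h2 : a - l = n - b := by omega
    rw [h2] at hab
    exact hne' (n - b) (by omega) hab.symm
  refine cycleGraph_isContained_of_seq f ?_ ?_ ?_
  · intro a ha b hb hab
    simp only [Set.mem_Iio] at ha hb
    rcases le_or_gt a l with h1 | h1
    · rcases le_or_gt b l with h2 | h2
      · rw [f1 a h1, f1 b h2] at hab
        exact hinj h1 h2 hab
      · exact absurd hab (low a b h1 h2 hb)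
    rcases le_or_gt b l with h2 | h2
    · exact absurd hab.symm (low b a h2 h1 ha)
    rcases le_or_gt a (l + (m + 1)) with h3 | h3
    · rcases le_or_gt b (l + (m + 1)) with h4 | h4
      · rw [f2 a h1.le h3, f2 b h2.le h4] at hab
        have h5 := hlevz (a - l) (by omega)
        rw [hab, hlevz _ (by omega), Nat.cast_inj] at h5
        omega
      · exact absurd hab (mid a b h1 h3 h4 hb)
    rcases le_or_gt b (l + (m + 1)) with h4 | h4
    · exact absurd hab.symm (mid b a h2 h4 h3 ha)
    · rw [f3 a h3.le ha.le, f3 b h4.le hb.le] at hab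
      have h5 := hlevx (n - a) (by omega)
      rw [hab, hlevx _ (by omega), Nat.cast_inj] at h5
      omega
  · intro t ht
    rcases lt_or_ge t l with h1 | h1
    · rw [f1 t h1.le, f1 (t + 1) h1]
      exact hadj t h1
    rcases lt_or_ge t (l + (m + 1)) with h2 | h2
    · rw [f2 t h1 h2.le, f2 (t + 1) (by omega) h2, show t + 1 - l = t - l + 1 by omega]
      exact hstep z hz _ (by omega)
    · rw [f3 t h2 (by omega), f3 (t + 1) (by omega) ht.le,
        show n - t = n - (t + 1) + 1 by omega]
      exact (hstep x hx _ (by omega)).symm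
  · rw [f3 (n - 1) (by omega) (by omega), f1 0 (by omega), h0, show n - (n - 1) = 0 + 1 by omega]
    exact (hstep x hx 0 (by omega)).symm

open Finset in
/-- In a `C_{2k}`-free graph with a layering rooted at `r`, no nonempty bipartite graph between
two consecutive levels `i`, `i + 1` with `i < k` has minimum degree at least `2 * k`. -/
lemma not_two_mul_le_degree_between_levels {V : Type*} [DecidableEq V] {G : SimpleGraph V}
    [DecidableRel G.Adj] {k : ℕ} (hfree : ¬ (cycleGraph (2 * k)).IsContained G)
    {lev : V → ℕ∞} {π : V → V} {r : V} (hr : ∀ v, lev v = 0 → v = r)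
    (hπ : ∀ (i : ℕ) v, lev v = (i + 1 : ℕ) → lev (π v) = i)
    (hadjπ : ∀ (i : ℕ) v, lev v = (i + 1 : ℕ) → G.Adj v (π v)) {i : ℕ} (hi : i < k)
    {X Y : Finset V} (hX : ∀ x ∈ X, lev x = i) (hY : ∀ y ∈ Y, lev y = (i + 1 : ℕ))
    (hne : X.Nonempty) (hdX : ∀ x ∈ X, 2 * k ≤ #{y ∈ Y | G.Adj x y})
    (hdY : ∀ y ∈ Y, 2 * k ≤ #{x ∈ X | G.Adj y x}) : False := by
  have hXY : Disjoint X Y := by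
    rw [Finset.disjoint_left]
    intro v h1 h2
    have h3 := hX v h1
    rw [hY v h2, Nat.cast_inj] at h3
    omega
  let Q : ℕ → Prop := fun n => ∀ y ∈ Y, ∀ x ∈ X, ∀ x' ∈ X, G.Adj y x → G.Adj y x' →
    π^[n] x = π^[n] x'
  have hroot : ∀ x ∈ X, π^[i] x = r := fun x hx => hr _ (by
    simpa using level_iterate_parent hπ (hX x hx) i le_rfl)
  have hQi : Q i := fun y _ x hx x' hx' _ _ => by rw [hroot x hx, hroot x' hx']
  have hQ0 : ¬ Q 0 := by
    intro h0
    obtain ⟨x, hx⟩ := hne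
    obtain ⟨y, hy⟩ := card_pos.1 (lt_of_lt_of_le (by omega) (hdX x hx))
    have hy := (mem_filter.1 hy).1
    obtain ⟨x, hx, x', hx', hxx⟩ := one_lt_card.1 (lt_of_lt_of_le (by omega) (hdY y hy))
    rw [mem_filter] at hx hx'
    exact hxx (h0 y hy x hx.1 x' hx'.1 hx.2 hx'.2)
  obtain ⟨m, hm, hQm, hQm1⟩ : ∃ m < i, ¬ Q m ∧ Q (m + 1) := by
    by_contra! hcon
    have : ∀ j ≤ i, ¬ Q j := by
      intro j
      induction j with
      | zero => exact fun _ => hQ0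
      | succ j ih => exact fun hj => hcon j hj (ih (by omega))
    exact this i le_rfl hQi
  simp only [Q] at hQm
  push Not at hQm
  obtain ⟨y, hy, x, hx, x', hx', hyx, hyx', hxx⟩ := hQm
  set t := 2 * k - 2 * (m + 1) - 1 with ht
  have hto : Odd t := ⟨k - (m + 1) - 1, by omega⟩
  obtain ⟨g, hg0, hgX, hgY, hgadj, hginj, hgF⟩ := exists_path_avoiding (F := {x, x'}) hXY
    (by simp [insert_subset_iff, hx, hx']) hdX hdY hy t
    (by have := card_le_two (a := x) (b := x'); omega)
  have hzX : g t ∈ X := hgX t le_rfl hto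
  have hanc : ∀ w ∈ X, G.Adj y w → ∀ s ≤ t, Odd s → π^[m + 1] w = π^[m + 1] (g s) := by
    intro w hw hyw s hs ho
    obtain ⟨c, rfl⟩ := ho
    induction c with
    | zero =>
      refine hQm1 y hy w hw _ (hgX _ hs (by simp)) hyw ?_
      have := hgadj 0 (by omega)
      rwa [hg0] at this
    | succ c ih =>
      rw [ih (by omega)]
      have h1 := hgadj (2 * c + 1) (by omega)
      have h2 := hgadj (2 * c + 2) (by omega)
      exact hQm1 _ (hgY (2 * c + 2) (by omega) ⟨c + 1, by ring⟩) _
        (hgX (2 * c + 1) (by omega) ⟨c, rfl⟩) _ (hgX _ hs ⟨c + 1, rfl⟩) h1.symm h2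
  have main : ∀ w ∈ X, G.Adj y w → (∀ s ≤ t, g s ≠ w) → π^[m] w ≠ π^[m] (g t) → False := by
    intro w hw hyw hgw hne
    have hlevg : ∀ s ≤ t, (i : ℕ∞) ≤ lev (g s) := by
      intro s hs
      rcases Nat.even_or_odd s with h | h
      · rw [hY _ (hgY s hs h), Nat.cast_le]
        omega
      · rw [hX _ (hgX s hs h)]
    have := cycleGraph_isContained_of_level_path hπ hadjπ hm (hX w hw) (hX _ hzX) hne
      (hanc w hw hyw t le_rfl hto) (l := t + 1) (fun s => if s = 0 then w else g (s - 1))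
      (by simp) (by simp) ?_ ?_ ?_
    · rw [show t + 1 + 2 * (m + 1) = 2 * k by omega] at this
      exact hfree this
    · rintro (_ | s) hs
      · simp [hX w hw]
      · simpa using hlevg s (by omega)
    · rintro (_ | a) ha (_ | b) hb hab
      · rfl
      · simp only [Set.mem_Iic] at hb
        simp only [if_true, Nat.add_one_ne_zero, if_false, Nat.add_sub_cancel] at hab
        exact absurd hab.symm (hgw b (by omega))
      · simp only [Set.mem_Iic] at ha
        simp only [if_true, Nat.add_one_ne_zero, if_false, Nat.add_sub_cancel] at hab
        exact absurd hab (hgw a (by omega))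
      · simp only [Set.mem_Iic] at ha hb
        simp only [Nat.add_one_ne_zero, if_false, Nat.add_sub_cancel] at hab
        rw [hginj (show a ∈ Set.Iic t by simp; omega) (show b ∈ Set.Iic t by simp; omega) hab]
    · rintro (_ | s) hs
      · simpa [hg0] using hyw.symm
      · simpa using hgadj s (by omega)
  by_cases hzx : π^[m] x = π^[m] (g t)
  · refine main x' hx' hyx' (fun s hs h => hgF s hs (by simp [h])) ?_
    rw [← hzx]
    exact hxx.symm
  · exact main x hx hyx (fun s hs h => hgF s hs (by simp [h])) hzx

lemma exists_parent_of_edist {V : Type*} {H : SimpleGraph V} {r v : V} {i : ℕ}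
    (h : H.edist r v = (i + 1 : ℕ)) : ∃ u, H.Adj v u ∧ H.edist r u = i := by
  obtain ⟨p, hp⟩ := exists_walk_of_edist_eq_coe h
  obtain ⟨q, hq⟩ : ∃ q : H.Walk v r, q.length = i + 1 := ⟨p.reverse, by simpa using hp⟩
  cases q with
  | nil => simp at hq
  | @cons _ u _ hadj q =>
    refine ⟨u, hadj, le_antisymm ?_ ?_⟩
    · have := H.edist_le q.reverse
      simp only [Walk.length_reverse, Walk.length_cons, Nat.add_right_cancel_iff] at this hq
      rwa [hq] at this
    · have h1 : H.edist r v ≤ H.edist r u + H.edist u v := H.edist_triangle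
      rw [edist_eq_one_iff_adj.2 hadj.symm, h, Nat.cast_add, Nat.cast_one] at h1
      exact (ENat.add_le_add_iff_right (by simp)).1 h1

open Finset in
/-- Between consecutive levels `i`, `i + 1`, `i < k`, of a breadth-first search in a
`C_{2k}`-free graph there are few edges. -/
lemma sum_card_adj_level_le {V : Type*} [Fintype V] [DecidableEq V] {H : SimpleGraph V}
    [DecidableRel H.Adj] {k : ℕ} (hfree : ¬ (cycleGraph (2 * k)).IsContained H) (r : V) {i : ℕ}
    (hi : i < k) (X Y : Finset V) (hX : ∀ x ∈ X, H.edist r x = i)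
    (hY : ∀ y ∈ Y, H.edist r y = (i + 1 : ℕ)) :
    ∑ x ∈ X, (#{y ∈ Y | H.Adj x y} : ℝ) ≤ 2 * k * (#X + #Y) := by
  by_contra! hlt
  obtain ⟨X', hX', Y', hY', hne, h1, h2⟩ := exists_subpair_le_degree H.Adj (2 * k) (2 * k) X Y
    (by linarith) (by positivity)
  have hpar : ∀ v, ∃ u, ∀ i : ℕ, H.edist r v = (i + 1 : ℕ) → H.Adj v u ∧ H.edist r u = i := by
    intro v
    by_cases h : ∃ i : ℕ, H.edist r v = (i + 1 : ℕ)
    · obtain ⟨i, hi⟩ := h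
      obtain ⟨u, hu⟩ := exists_parent_of_edist hi
      refine ⟨u, fun j hj => ?_⟩
      rw [hi, Nat.cast_inj] at hj
      obtain rfl : i = j := by omega
      exact hu
    · exact ⟨v, fun i hi => absurd ⟨i, hi⟩ h⟩
  choose π hπ using hpar
  refine not_two_mul_le_degree_between_levels hfree (lev := H.edist r) (π := π) (r := r)
    (fun v hv => (edist_eq_zero_iff.1 hv).symm) (fun i v hv => (hπ v i hv).2)
    (fun i v hv => (hπ v i hv).1) hi (fun x hx => hX x (hX' hx)) (fun y hy => hY y (hY' hy))
    hne (fun x hx => by exact_mod_cast h1 x hx) (fun y hy => ?_)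
  simp_rw [H.adj_comm y]
  exact_mod_cast h2 y hy

open Finset in
/-- Growth of breadth-first search levels in a `C_{2k}`-free graph without edges inside levels. -/
lemma prod_le_card_level {V : Type*} [Fintype V] [DecidableEq V] {H : SimpleGraph V}
    [DecidableRel H.Adj] {k : ℕ} (hfree : ¬ (cycleGraph (2 * k)).IsContained H) (r : V)
    (D : ℕ → ℝ) (hD : ∀ i, 12 * (k : ℝ) ≤ D i)
    (hdeg : ∀ (i : ℕ) v, H.edist r v = i → D i ≤ #{w | H.Adj v w})
    (hbip : ∀ (i : ℕ) u v, H.Adj u v → H.edist r u = i → H.edist r v ≠ i)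
    (S : Finset V) (hS : ∀ v, H.edist r v = k → v ∈ S) :
    ∏ i ∈ range k, D i ≤ (4 * k) ^ k * #S := by
  classical
  set L : ℕ → Finset V := fun i => {v | H.edist r v = i} with hL
  have memL : ∀ i v, v ∈ L i ↔ H.edist r v = i := fun i v => by simp [hL]
  set e : ℕ → ℝ := fun i => ∑ x ∈ L i, (#{y ∈ L (i + 1) | H.Adj x y} : ℝ) with he
  have hle : ∀ i < k, e i ≤ 2 * k * (#(L i) + #(L (i + 1))) := fun i hi =>
    sum_card_adj_level_le hfree r hi _ _ (fun x hx => (memL _ _).1 hx)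
      (fun y hy => (memL _ _).1 hy)
  have hswap : ∀ i, ∑ y ∈ L (i + 1), (#{x ∈ L i | H.Adj y x} : ℝ) = e i := fun i => by
    have := sum_card_bipartiteAbove_eq_sum_card_bipartiteBelow (s := L i) (t := L (i + 1)) H.Adj
    simp only [bipartiteAbove, bipartiteBelow] at this
    have hcomm : ∀ y, ({x ∈ L i | H.Adj y x} : Finset V) = {x ∈ L i | H.Adj x y} := fun y =>
      filter_congr fun x _ => H.adj_comm y x
    simp only [he]
    simp_rw [hcomm]
    exact_mod_cast this.symm
  have hnear : ∀ i v w, v ∈ L i → H.Adj v w → (∃ j, w ∈ L j ∧ j ≤ i + 1 ∧ i ≤ j + 1 ∧ j ≠ i) := by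
    intro i v w hv hvw
    rw [memL] at hv
    have h1 : H.edist r w ≤ H.edist r v + H.edist v w := H.edist_triangle
    have h2 : H.edist r v ≤ H.edist r w + H.edist w v := H.edist_triangle
    rw [edist_eq_one_iff_adj.2 hvw, hv] at h1
    rw [edist_eq_one_iff_adj.2 hvw.symm, hv] at h2
    have h3 : H.edist r w ≠ ⊤ := fun h => by
      rw [h] at h1
      exact absurd h1 (by simp)
    obtain ⟨j, hj⟩ := ENat.ne_top_iff_exists.1 h3
    rw [← hj] at h1 h2
    refine ⟨j, (memL _ _).2 hj.symm, by exact_mod_cast h1, by exact_mod_cast h2, ?_⟩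
    rintro rfl
    exact hbip j v w hvw hv hj.symm
  have hzero : D 0 * #(L 0) ≤ e 0 := by
    rw [mul_comm, ← nsmul_eq_mul]
    refine card_nsmul_le_sum _ _ _ fun v hv => (hdeg 0 v ((memL _ _).1 hv)).trans ?_
    norm_cast
    refine card_le_card fun w hw => ?_
    simp only [mem_filter, mem_univ, true_and] at hw
    obtain ⟨j, hj, h1, h2, h3⟩ := hnear _ _ _ hv hw
    obtain rfl : j = 1 := by omega
    exact mem_filter.2 ⟨hj, hw⟩
  have hsucc : ∀ i, D (i + 1) * #(L (i + 1)) ≤ e i + e (i + 1) := by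
    intro i
    rw [← hswap i, he, ← sum_add_distrib, mul_comm, ← nsmul_eq_mul]
    refine card_nsmul_le_sum _ _ _ fun v hv => (hdeg _ v ((memL _ _).1 hv)).trans ?_
    norm_cast
    refine le_trans (card_le_card fun w hw => ?_) (card_union_le _ _)
    simp only [mem_filter, mem_univ, true_and] at hw
    obtain ⟨j, hj, h1, h2, h3⟩ := hnear _ _ _ hv hw
    obtain rfl | rfl : j = i ∨ j = i + 1 + 1 := by omega
    · exact mem_union_left _ (mem_filter.2 ⟨hj, hw⟩)
    · exact mem_union_right _ (mem_filter.2 ⟨hj, hw⟩)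
  have key : ∀ i < k, D i * #(L i) ≤ 2 * k * (3 * #(L i) + #(L (i + 1))) →
      D i * #(L i) ≤ 4 * k * #(L (i + 1)) ∧ (#(L i) : ℝ) ≤ #(L (i + 1)) := by
    intro i hi h
    have hk : (1 : ℝ) ≤ k := by exact_mod_cast (by omega : 1 ≤ k)
    have h1 : 12 * (k : ℝ) * #(L i) ≤ D i * #(L i) := by
      gcongr
      exact hD i
    have h2 : (0 : ℝ) ≤ #(L i) := by positivity
    refine ⟨by linarith, ?_⟩
    have : (k : ℝ) * #(L i) ≤ k * #(L (i + 1)) := by nlinarith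
    exact le_of_mul_le_mul_left this (by linarith)
  have hgrow : ∀ i < k, D i * #(L i) ≤ 4 * k * #(L (i + 1)) ∧ (#(L i) : ℝ) ≤ #(L (i + 1)) := by
    intro i hi
    induction i with
    | zero =>
      refine key _ hi ?_
      have h1 := hle 0 hi
      have h2 : (0 : ℝ) ≤ k * #(L 0) := by positivity
      nlinarith
    | succ i ih =>
      refine key _ hi ?_
      have h0 := (ih (by omega)).2
      have h1 := hle i (by omega)
      have h2 := hle (i + 1) hi
      have h3 := hsucc i
      have h4 : (k : ℝ) * #(L i) ≤ k * #(L (i + 1)) := by gcongr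
      nlinarith
  have hind : ∀ n ≤ k, ∏ i ∈ range n, D i ≤ (4 * k) ^ n * #(L n) := by
    intro n hn
    induction n with
    | zero =>
      have : 0 < #(L 0) := card_pos.2 ⟨r, by simp [memL]⟩
      simpa using this
    | succ n ih =>
      have hDn : 0 ≤ D n := le_trans (by positivity) (hD n)
      rw [prod_range_succ]
      calc (∏ i ∈ range n, D i) * D n ≤ (4 * k) ^ n * #(L n) * D n := by
            gcongr
            exact ih (by omega)
        _ = (4 * k) ^ n * (D n * #(L n)) := by ring
        _ ≤ (4 * k) ^ n * (4 * k * #(L (n + 1))) := by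
            exact mul_le_mul_of_nonneg_left (hgrow n (by omega)).1 (by positivity)
        _ = _ := by ring
  refine (hind k le_rfl).trans ?_
  gcongr
  exact fun v hv => hS v ((memL _ _).1 hv)

open Finset in
/-- Breadth-first search from one side of a bipartite `C_{2k}`-free graph of large degrees. -/
lemma prod_degree_le_card_part {V : Type*} [Fintype V] [DecidableEq V] {H : SimpleGraph V}
    [DecidableRel H.Adj] {k : ℕ} (hfree : ¬ (cycleGraph (2 * k)).IsContained H)
    {S T : Finset V} (hST : H.IsBipartiteWith (S : Set V) T) {p q : ℝ} (hp : 12 * (k : ℝ) ≤ p)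
    (hq : 12 * (k : ℝ) ≤ q) (hS : ∀ v ∈ S, p ≤ #{w | H.Adj v w})
    (hT : ∀ v ∈ T, q ≤ #{w | H.Adj v w}) (hne : S.Nonempty) :
    ∏ i ∈ range k, (if Even i then p else q) ≤ (4 * k) ^ k * #(if Even k then S else T) := by
  obtain ⟨r, hr⟩ := hne
  have hdisj : ∀ v, v ∈ S → v ∉ T := fun v h1 h2 =>
    Set.disjoint_left.1 hST.disjoint (mem_coe.2 h1) (mem_coe.2 h2)
  have hpar : ∀ (i : ℕ) v, H.edist r v = i → v ∈ (if Even i then S else T) := by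
    intro i
    induction i with
    | zero =>
      intro v hv
      rw [Nat.cast_zero, edist_eq_zero_iff] at hv
      simpa [← hv] using hr
    | succ i ih =>
      intro v hv
      obtain ⟨u, huv, hu⟩ := exists_parent_of_edist hv
      have h1 := ih u hu
      have h2 := hST.mem_of_adj huv
      simp only [mem_coe] at h2
      have h3 := hdisj u
      by_cases h : Even i
      · simp only [h, if_true, Nat.even_add_one, not_true, if_false] at h1 ⊢
        tauto
      · simp only [h, if_true, Nat.even_add_one, not_false_eq_true, if_false] at h1 ⊢
        tauto
  refine prod_le_card_level hfree r _ ?_ ?_ ?_ _ (hpar k)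
  · intro i
    split_ifs <;> assumption
  · intro i v hv
    have := hpar i v hv
    split_ifs with h
    · exact hS v (by simpa [h] using this)
    · exact hT v (by simpa [h] using this)
  · intro i u v huv hu hv
    have h1 := hpar i u hu
    have h2 := hpar i v hv
    have h3 := hST.mem_of_adj huv
    simp only [mem_coe] at h3
    have h4 := hdisj u
    have h5 := hdisj v
    split_ifs at h1 h2 <;> tauto

open Finset in
lemma mul_degree_pow_le_card_mul_card {V : Type*} [Fintype V] [DecidableEq V] {H : SimpleGraph V}
    [DecidableRel H.Adj] {k : ℕ} (hfree : ¬ (cycleGraph (2 * k)).IsContained H)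
    {S T : Finset V} (hST : H.IsBipartiteWith (S : Set V) T) {p q : ℝ} (hp : 12 * (k : ℝ) ≤ p)
    (hq : 12 * (k : ℝ) ≤ q) (hS : ∀ v ∈ S, p ≤ #{w | H.Adj v w})
    (hT : ∀ v ∈ T, q ≤ #{w | H.Adj v w}) (hneS : S.Nonempty) (hneT : T.Nonempty) :
    (p * q) ^ k ≤ (4 * k) ^ (2 * k) * (#S * #T) := by
  have h1 := prod_degree_le_card_part hfree hST hp hq hS hT hneS
  have h2 := prod_degree_le_card_part hfree hST.symm hq hp hT hS hneT
  have hk : (0 : ℝ) ≤ 12 * k := by positivity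
  have h0 : ∀ i ∈ range k, 0 ≤ (if Even i then q else p) := fun i _ => by
    split_ifs <;> linarith
  have h3 := mul_le_mul h1 h2 (prod_nonneg h0) (by positivity)
  rw [← prod_mul_distrib] at h3
  have h4 : ∀ i ∈ range k, (if Even i then p else q) * (if Even i then q else p) = p * q :=
    fun i _ => by split_ifs <;> ring
  rw [prod_congr rfl h4, prod_const, card_range] at h3
  refine h3.trans_eq ?_
  split_ifs <;> ring

open Finset in
/-- Some vertex set `X` separates at least a quarter of the given ordered pairs. -/
lemma exists_card_le_four_mul_card_cut {V : Type*} [Fintype V] [DecidableEq V]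
    (P : Finset (V × V)) (hP : ∀ e ∈ P, e.1 ≠ e.2) :
    ∃ X : Finset V, #P ≤ 4 * #{e ∈ P | e.1 ∈ X ∧ e.2 ∉ X} := by
  have hcount : ∀ e ∈ P, Fintype.card (Finset V) ≤
      4 * #{X : Finset V | e.1 ∈ X ∧ e.2 ∉ X} := by
    rintro ⟨u, v⟩ he
    have huv : u ≠ v := hP _ he
    have : #(univ : Finset (Finset V)) ≤ #((univ : Finset (Bool × Bool)) ×ˢ
        ({X : Finset V | u ∈ X ∧ v ∉ X} : Finset (Finset V))) := by
      refine card_le_card_of_injOn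
        (fun X => ((decide (u ∈ X), decide (v ∈ X)), (insert u X).erase v)) ?_ ?_
      · intro X _
        simp [huv]
      · intro X _ Y _ h
        simp only [Prod.mk.injEq, decide_eq_decide] at h
        obtain ⟨⟨h1, h2⟩, h3⟩ := h
        ext w
        have h4 := congrArg (w ∈ ·) h3
        simp only [mem_erase, mem_insert, eq_iff_iff] at h4
        by_cases hu : w = u
        · rw [hu, h1]
        by_cases hv : w = v
        · rw [hv, h2]
        simpa [hu, hv] using h4
    simpa [card_product] using this
  by_contra! hcon
  have h1 := sum_lt_sum_of_nonempty (univ_nonempty (α := Finset V)) fun X _ => hcon X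
  have h2 := sum_card_bipartiteAbove_eq_sum_card_bipartiteBelow (s := (univ : Finset (Finset V)))
    (t := P) fun X e => e.1 ∈ X ∧ e.2 ∉ X
  simp only [bipartiteAbove, bipartiteBelow] at h2
  rw [← mul_sum, h2, mul_sum] at h1
  have h3 := sum_le_sum hcount
  simp only [sum_const, card_univ, smul_eq_mul] at h1 h3
  rw [mul_comm] at h3
  omega

open Finset in
lemma card_filter_adj_product_le_card_edgeFinset {V : Type*} [Fintype V] [DecidableEq V]
    (G : SimpleGraph V) [DecidableRel G.Adj] {S T : Finset V} (hST : Disjoint S T) :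
    #{e ∈ S ×ˢ T | G.Adj e.1 e.2} ≤ #G.edgeFinset := by
  refine card_le_card_of_injOn (fun e => s(e.1, e.2)) ?_ ?_
  · rintro ⟨u, v⟩ h
    simp only [coe_filter, mem_product, Set.mem_ofPred_eq] at h
    simpa using h.2
  · rintro ⟨u, v⟩ h ⟨u', v'⟩ h' heq
    simp only [coe_filter, mem_product, Set.mem_ofPred_eq] at h h'
    simp only [Sym2.eq_iff] at heq
    rcases heq with ⟨rfl, rfl⟩ | ⟨rfl, rfl⟩
    · rfl
    · exact absurd h'.1.2 (Finset.disjoint_left.1 hST h.1.1)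

open Finset in
/-- Either the average degree on one side is bounded, or the number of edges between two disjoint
sets `S`, `T` in a `C_{2k}`-free graph satisfies an asymmetric Bondy–Simonovits bound. The
parameters `a`, `b` are upper bounds for the sizes of the two sets. -/
lemma card_edges_between_bound {V : Type*} [Fintype V] [DecidableEq V] {G : SimpleGraph V}
    [DecidableRel G.Adj] {k : ℕ} (hk : 0 < k) (hfree : ¬ (cycleGraph (2 * k)).IsContained G)
    {S T : Finset V} (hST : Disjoint S T) {a b : ℝ} (ha : #S ≤ a) (hb : #T ≤ b) (ha0 : 0 < a)
    (hb0 : 0 < b) {E : ℝ} (hE : E = #{e ∈ S ×ˢ T | G.Adj e.1 e.2}) :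
    E ≤ 48 * k * a ∨ E ≤ 48 * k * b ∨ (E ^ 2) ^ k ≤ ((16 * k) ^ 2) ^ k * (a * b) ^ (k + 1) := by
  classical
  rcases le_or_gt E (48 * k * a) with h1 | h1
  · exact Or.inl h1
  rcases le_or_gt E (48 * k * b) with h2 | h2
  · exact Or.inr (Or.inl h2)
  refine Or.inr (Or.inr ?_)
  have hk' : (0 : ℝ) < k := by exact_mod_cast hk
  have hE0 : 0 < E := lt_trans (by positivity) h1
  have hp : 12 * (k : ℝ) ≤ E / (4 * a) := by
    rw [le_div_iff₀ (by positivity)]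
    linarith
  have hq : 12 * (k : ℝ) ≤ E / (4 * b) := by
    rw [le_div_iff₀ (by positivity)]
    linarith
  have hsum : E = ∑ x ∈ S, (#{y ∈ T | G.Adj x y} : ℝ) := by
    rw [hE]
    norm_cast
    simp only [card_filter, sum_product]
  obtain ⟨S', hS', T', hT', hne, hdS, hdT⟩ := exists_subpair_le_degree G.Adj (E / (4 * a))
    (E / (4 * b)) S T (by
      rw [← hsum]
      have e1 : E / (4 * a) * #S ≤ E / (4 * a) * a := by gcongr
      have e2 : E / (4 * b) * #T ≤ E / (4 * b) * b := by gcongr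
      have e3 : E / (4 * a) * a = E / 4 := by field_simp
      have e4 : E / (4 * b) * b = E / 4 := by field_simp
      linarith) (by positivity)
  have hneT : T'.Nonempty := by
    obtain ⟨x, hx⟩ := hne
    have : (0 : ℝ) < #{y ∈ T' | G.Adj x y} := lt_of_lt_of_le (by positivity) (hdS x hx)
    obtain ⟨y, hy⟩ := card_pos.1 (by exact_mod_cast this)
    exact ⟨y, (mem_filter.1 hy).1⟩
  have hdisj : Disjoint (S' : Set V) T' := by
    exact_mod_cast hST.mono hS' hT'
  have hbip : (G.between (S' : Set V) T').IsBipartiteWith (S' : Set V) T' :=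
    ⟨hdisj, fun v w h => h.2⟩
  have key := mul_degree_pow_le_card_mul_card (k := k)
    (fun h => hfree (h.mono_right between_le)) hbip hp hq
    (fun v hv => (hdS v hv).trans (by
      norm_cast
      refine card_le_card fun w hw => ?_
      rw [mem_filter] at hw
      simp [between_adj, hw.1, hw.2, hv]))
    (fun v hv => (hdT v hv).trans (by
      norm_cast
      refine card_le_card fun w hw => ?_
      rw [mem_filter] at hw
      simp [between_adj, hw.1, hw.2.symm, hv])) hne hneT
  have hS'a : (#S' : ℝ) ≤ a := le_trans (by exact_mod_cast card_le_card hS') ha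
  have hT'b : (#T' : ℝ) ≤ b := le_trans (by exact_mod_cast card_le_card hT') hb
  have hE2 : E ^ 2 = E / (4 * a) * (E / (4 * b)) * (16 * (a * b)) := by
    field_simp
    norm_num
  calc (E ^ 2) ^ k = (E / (4 * a) * (E / (4 * b))) ^ k * (16 * (a * b)) ^ k := by
        rw [← mul_pow, ← hE2]
    _ ≤ (4 * k) ^ (2 * k) * (a * b) * (16 * (a * b)) ^ k := by
        gcongr
        exact key.trans (by gcongr)
    _ = ((4 * k) ^ 2 * 16) ^ k * (a * b) ^ (k + 1) := by
        rw [pow_mul, mul_pow 16 (a * b), mul_pow ((4 * (k : ℝ)) ^ 2) 16, pow_succ (a * b)]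
        ring
    _ = _ := by
        congr 2
        ring

open Finset in
/-- The squared form of the key lemma, with `M` standing for `m ^ (2 / (k + 1))` and `B` for any
set of vertices with between `d / 2` and `d` neighbours in `A`. -/
lemma sq_mul_card_le_of_cycleGraph_free {V : Type*} [Fintype V] [DecidableEq V]
    {G : SimpleGraph V} [DecidableRel G.Adj] {k : ℕ} (hk : 0 < k)
    (hfree : ¬ (cycleGraph (2 * k)).IsContained G) {M : ℝ}
    (hM : M ^ (k + 1) = (#G.edgeFinset : ℝ) ^ 2) (hΔ : (G.maxDegree : ℝ) ≤ M) (A B : Finset V)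
    {d : ℕ} (hd : 0 < d) (hdΔ : d ≤ G.maxDegree)
    (hB : ∀ v ∈ B, (d : ℝ) / 2 ≤ #(G.neighborFinset v ∩ A)) :
    (d : ℝ) ^ 2 * #B ≤ (128 * k) ^ 2 * M * #A := by
  have hk1 : (1 : ℝ) ≤ k := by exact_mod_cast hk
  have hd0 : (0 : ℝ) < d := by exact_mod_cast hd
  have hdM : (d : ℝ) ≤ M := le_trans (by exact_mod_cast hdΔ) hΔ
  have hM0 : 0 < M := hd0.trans_le hdM
  rcases B.eq_empty_or_nonempty with rfl | hBne
  · simp only [card_empty, CharP.cast_eq_zero, mul_zero]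
    positivity
  have hb : (0 : ℝ) < #B := by exact_mod_cast card_pos.2 hBne
  set P : Finset (V × V) := {e ∈ A ×ˢ B | G.Adj e.1 e.2} with hP
  have hPA : #P = ∑ u ∈ A, #{v ∈ B | G.Adj u v} := by
    simp only [hP, card_filter, sum_product]
  have hPB : #P = ∑ v ∈ B, #{u ∈ A | G.Adj u v} := by
    simp only [hP, card_filter, sum_product_right]
  have hPle : (#P : ℝ) ≤ M * #A := by
    have : #P ≤ #A • G.maxDegree := by
      rw [hPA]
      refine sum_le_card_nsmul _ _ _ fun u _ => le_trans ?_ (G.degree_le_maxDegree u)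
      refine card_le_card fun v hv => ?_
      simpa using (mem_filter.1 hv).2
    calc (#P : ℝ) ≤ #A * G.maxDegree := by exact_mod_cast this
      _ ≤ #A * M := by gcongr
      _ = _ := mul_comm _ _
  have hPge : (d : ℝ) * #B ≤ 2 * #P := by
    have : #B • ((d : ℝ) / 2) ≤ ∑ v ∈ B, (#{u ∈ A | G.Adj u v} : ℝ) := by
      refine card_nsmul_le_sum _ _ _ fun v hv => (hB v hv).trans ?_
      norm_cast
      refine card_le_card fun u hu => ?_
      simp only [mem_inter, mem_neighborFinset] at hu
      exact mem_filter.2 ⟨hu.2, hu.1.symm⟩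
    rw [hPB]
    push_cast
    rw [nsmul_eq_mul] at this
    linarith
  have ha : (0 : ℝ) < #A := by
    by_contra! h
    have h1 : (0 : ℝ) < d * #B := by positivity
    nlinarith
  obtain ⟨X, hX⟩ := exists_card_le_four_mul_card_cut P fun e he => (mem_filter.1 he).2.ne
  set S := A ∩ X
  set T := B \ X
  have hST : Disjoint S T := disjoint_sdiff.mono_left inter_subset_right
  have hcut : ({e ∈ P | e.1 ∈ X ∧ e.2 ∉ X} : Finset (V × V)) =
      {e ∈ S ×ˢ T | G.Adj e.1 e.2} := by
    ext e
    simp only [hP, S, T, mem_filter, mem_product, mem_inter, mem_sdiff]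
    tauto
  rw [hcut] at hX
  obtain ⟨E, hE⟩ : ∃ E : ℝ, E = #{e ∈ S ×ˢ T | G.Adj e.1 e.2} := ⟨_, rfl⟩
  have hX' : (#P : ℝ) ≤ 4 * E := by
    rw [hE]
    exact_mod_cast hX
  have hE0 : 0 ≤ E := by
    rw [hE]
    positivity
  have hEm : E ≤ #G.edgeFinset := by
    rw [hE]
    exact_mod_cast card_filter_adj_product_le_card_edgeFinset G hST
  have hconst : 768 * (k : ℝ) ≤ (128 * k) ^ 2 := by nlinarith
  have hMA : 0 < M * #A := by positivity
  have hfin : 768 * (k : ℝ) * (M * #A) ≤ (128 * k) ^ 2 * M * #A := by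
    rw [mul_assoc _ M]
    gcongr
  rcases card_edges_between_bound hk hfree hST (a := #A) (b := #B)
    (by exact_mod_cast card_le_card inter_subset_left)
    (by exact_mod_cast card_le_card sdiff_subset) ha hb hE with h | h | h
  · refine le_trans ?_ hfin
    have h1 : (d : ℝ) * #B ≤ 384 * k * #A := by linarith
    have h2 : (0 : ℝ) ≤ k * (M * #A) := by positivity
    calc (d : ℝ) ^ 2 * #B = d * (d * #B) := by ring
      _ ≤ M * (384 * k * #A) := by gcongr
      _ ≤ _ := by linarith
  · refine le_trans ?_ hfin
    have h1 : (d : ℝ) ≤ 384 * k := le_of_mul_le_mul_right (by linarith) hb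
    calc (d : ℝ) ^ 2 * #B = d * (d * #B) := by ring
      _ ≤ 384 * k * (2 * (M * #A)) :=
        mul_le_mul h1 (by linarith) (by positivity) (by positivity)
      _ = _ := by ring
  · have h1 : (E ^ 2) ^ (k + 1) ≤ ((16 * k) ^ 2 * M * (#A * #B)) ^ (k + 1) := by
      calc (E ^ 2) ^ (k + 1) = (E ^ 2) ^ k * E ^ 2 := pow_succ _ _
        _ ≤ ((16 * k) ^ 2) ^ k * (#A * #B) ^ (k + 1) * M ^ (k + 1) := by
          rw [hM]
          gcongr
        _ ≤ ((16 * k) ^ 2) ^ (k + 1) * (#A * #B) ^ (k + 1) * M ^ (k + 1) := by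
          gcongr
          · nlinarith
          · omega
        _ = _ := by rw [mul_pow, mul_pow]; ring
    have h2 : E ^ 2 ≤ (16 * k) ^ 2 * M * (#A * #B) :=
      le_of_pow_le_pow_left₀ (by omega) (by positivity) h1
    have h3 : (d : ℝ) * #B ≤ 8 * E := by linarith
    have h4 : ((d : ℝ) * #B) ^ 2 ≤ (8 * E) ^ 2 := by gcongr
    refine le_of_mul_le_mul_right (a := (#B : ℝ)) ?_ hb
    nlinarith

/-- Key lemma for `C_{2k}`-free graphs with small maximum degree: if `B` is the set of
vertices with between `d/2` and `d` neighbors in `A`, then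
`d·√|B| ≤ C_k·m^(1/(k+1))·√|A|`. -/
theorem key_lemma_C2k_free (k : ℕ) (hk : 2 ≤ k) :
    ∃ C : ℝ, 0 < C ∧
      ∀ (V : Type) [Fintype V] [DecidableEq V] (G : SimpleGraph V) [DecidableRel G.Adj],
        (¬ ∃ H : G.Subgraph, Nonempty (H.coe ≃g cycleGraph (2 * k))) →
        (G.maxDegree : ℝ) ≤ (G.edgeFinset.card : ℝ) ^ (2 / ((k : ℝ) + 1)) →
        ∀ (A : Finset V) (d : ℕ), 0 < d → d ≤ G.maxDegree →
          (d : ℝ) * Real.sqrt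
              (({v : V | (d : ℝ) / 2 ≤ ((G.neighborFinset v ∩ A).card : ℝ) ∧
                  (G.neighborFinset v ∩ A).card ≤ d}).ncard) ≤
            C * (G.edgeFinset.card : ℝ) ^ (1 / ((k : ℝ) + 1)) * Real.sqrt (A.card) := by
  refine ⟨128 * k, by positivity, ?_⟩
  intro V _ _ G _ hfree hΔ A d hd hdΔ
  classical
  have hfree' : ¬ (cycleGraph (2 * k)).IsContained G := fun h => by
    obtain ⟨H, ⟨e⟩⟩ := isContained_iff_exists_iso_subgraph.1 h
    exact hfree ⟨H, ⟨e.symm⟩⟩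
  set m : ℝ := (G.edgeFinset.card : ℝ) with hm
  have hm0 : 0 ≤ m := by positivity
  set B : Finset V := {v | (d : ℝ) / 2 ≤ ((G.neighborFinset v ∩ A).card : ℝ) ∧
    (G.neighborFinset v ∩ A).card ≤ d} with hB
  have hBcard : {v : V | (d : ℝ) / 2 ≤ ((G.neighborFinset v ∩ A).card : ℝ) ∧
      (G.neighborFinset v ∩ A).card ≤ d}.ncard = B.card := by
    rw [← Set.ncard_coe_finset, hB, Finset.coe_filter]
    simp
  rw [hBcard]
  have hk0 : (k : ℝ) + 1 ≠ 0 := by positivity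
  have hM : (m ^ (2 / ((k : ℝ) + 1))) ^ (k + 1) = m ^ 2 := by
    rw [← Real.rpow_natCast, ← Real.rpow_mul hm0, ← Real.rpow_natCast m 2]
    congr 1
    push_cast
    field_simp
  have hsq : m ^ (2 / ((k : ℝ) + 1)) = (m ^ (1 / ((k : ℝ) + 1))) ^ 2 := by
    rw [← Real.rpow_natCast, ← Real.rpow_mul hm0]
    congr 1
    push_cast
    ring
  have key := sq_mul_card_le_of_cycleGraph_free (by omega) hfree' hM hΔ A B hd hdΔ
    (fun v hv => (Finset.mem_filter.1 hv).2.1)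
  rw [hsq] at key
  refine le_of_pow_le_pow_left₀ two_ne_zero (by positivity) ?_
  rw [mul_pow, mul_pow, mul_pow, Real.sq_sqrt (by positivity), Real.sq_sqrt (by positivity)]
  exact key
end
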